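/- arXiv:2411.19521 — 9 statements merged into one kernel-verified Lean document; each statement's English description precedes it below -/
import Mathlib

section
/- Let M be a matroid with finite ground set E, let S ⊆ E be a crowding record, and let X ⊆ S be a summand of S. Then X is a crowding record; in particular stress(X) ≥ 0. -/
/-- The crowding of a set `S` in a matroid with rank function `rank`:
`stress S = |S| - 2 * rank S`. -/
def stress {α : Type*} (rank : Finset α → ℕ) (S : Finset α) : ℤ :=
  (S.card : ℤ) - 2 * (rank S : ℤ)

/-- `T` is a summand of `S` if `rank T + rank (S \ T) = rank S`. -/
def IsSummand {α : Type*} [DecidableEq α] (rank : Finset α → ℕ) (T S : Finset α) : Prop :=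
  rank T + rank (S \ T) = rank S

/-- `T` is overcrowded in `S` if either `stress T > stress S`, or `stress T = stress S`
and `T` is not a summand of `S`. -/
def Overcrowded {α : Type*} [DecidableEq α] (rank : Finset α → ℕ) (T S : Finset α) : Prop :=
  stress rank S < stress rank T ∨
    (stress rank T = stress rank S ∧ ¬ IsSummand rank T S)

/-- `S` is a crowding record if no subset of `S` is overcrowded in `S`. -/
def CrowdingRecord {α : Type*} [DecidableEq α] (rank : Finset α → ℕ) (S : Finset α) : Prop :=
  ∀ T ⊆ S, ¬ Overcrowded rank T S

/-- If `X` is a summand of `S`, then rank is additive on `T ∪ (S \ X)` for every `T ⊆ X`. -/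
theorem IsSummand.rank_union_sdiff {α : Type*} [DecidableEq α] {rank : Finset α → ℕ}
    (hrank_submod : ∀ S T : Finset α, rank (S ∪ T) + rank (S ∩ T) ≤ rank S + rank T)
    {S T X : Finset α} (hX : IsSummand rank X S) (hXS : X ⊆ S) (hTX : T ⊆ X) :
    rank (T ∪ (S \ X)) = rank T + rank (S \ X) := by
  have hle := hrank_submod T (S \ X)
  have hge := hrank_submod (T ∪ (S \ X)) X
  rw [show T ∪ (S \ X) ∪ X = S by grind, show (T ∪ (S \ X)) ∩ X = T by grind] at hge
  unfold IsSummand at hX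
  omega

/-- If `X` is a summand of `S`, then crowding is additive on `T ∪ (S \ X)` for every `T ⊆ X`. -/
theorem IsSummand.stress_union_sdiff {α : Type*} [DecidableEq α] {rank : Finset α → ℕ}
    (hrank_submod : ∀ S T : Finset α, rank (S ∪ T) + rank (S ∩ T) ≤ rank S + rank T)
    {S T X : Finset α} (hX : IsSummand rank X S) (hXS : X ⊆ S) (hTX : T ⊆ X) :
    stress rank (T ∪ (S \ X)) = stress rank T + stress rank (S \ X) := by
  have hdisj : Disjoint T (S \ X) := Finset.disjoint_sdiff.mono_left hTX
  rw [stress, stress, stress, hX.rank_union_sdiff hrank_submod hXS hTX,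
    Finset.card_union_of_disjoint hdisj]
  push_cast
  ring

/-- Let `M` be a matroid with finite ground set `E`, let `S ⊆ E` be a crowding
record, and let `X ⊆ S` be a summand of `S`. Then `X` is a crowding record; in particular
`stress X ≥ 0`. -/
theorem crowdingRecord_of_summand {α : Type*} [Fintype α] [DecidableEq α]
    (rank : Finset α → ℕ)
    (hrank_empty : rank ∅ = 0)
    (hrank_mono : ∀ ⦃S T : Finset α⦄, S ⊆ T → rank S ≤ rank T)
    (hrank_submod : ∀ S T : Finset α, rank (S ∪ T) + rank (S ∩ T) ≤ rank S + rank T)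
    (hrank_step : ∀ (S : Finset α) (e : α), rank (insert e S) ≤ rank S + 1)
    (S X : Finset α) (hXS : X ⊆ S)
    (hS : CrowdingRecord rank S)
    (hX : IsSummand rank X S) :
    CrowdingRecord rank X ∧ 0 ≤ stress rank X := by
  have record : CrowdingRecord rank X := by
    intro T hTX hT
    have hsub : T ∪ (S \ X) ⊆ S := by grind
    have hstressT := hX.stress_union_sdiff hrank_submod hXS hTX
    have hstressX := hX.stress_union_sdiff hrank_submod hXS subset_rfl
    rw [Finset.union_sdiff_of_subset hXS] at hstressX
    refine hS _ hsub ?_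
    rcases hT with hlt | ⟨heq, hnot⟩
    · left
      omega
    · refine Or.inr ⟨by omega, fun hsum => hnot ?_⟩
      have hrankT := hX.rank_union_sdiff hrank_submod hXS hTX
      unfold IsSummand at hX hsum ⊢
      rw [show S \ (T ∪ (S \ X)) = X \ T by grind] at hsum
      omega
  refine ⟨record, ?_⟩
  by_contra! hneg
  refine record ∅ (Finset.empty_subset X) (Or.inl ?_)
  simpa [stress, hrank_empty] using hneg
end

section
/- Let M be a matroid of rank r ≥ 1 with finite ground set E of cardinality 2r + 1. Then there exist at least two distinct minimal nonempty crowded subsets of E, i.e., at least two distinct nonempty crowded sets T ⊆ E such that no nonempty proper subset of T is crowded. -/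
/-- `T` is a minimal nonempty crowded subset: `T` is nonempty and crowded
(`stress T ≥ 0`), and no nonempty proper subset of `T` is crowded. -/
def MinNonemptyCrowded {α : Type*} (rank : Finset α → ℕ) (T : Finset α) : Prop :=
  T ≠ ∅ ∧ 0 ≤ stress rank T ∧ ∀ T' : Finset α, T' ⊂ T → T' ≠ ∅ → stress rank T' < 0

/-- Every nonempty crowded set contains a minimal nonempty crowded subset. -/
theorem exists_minNonemptyCrowded_subset {α : Type*} (rank : Finset α → ℕ) {S : Finset α}
    (hne : S ≠ ∅) (hS : 0 ≤ stress rank S) : ∃ T ⊆ S, MinNonemptyCrowded rank T := by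
  induction S using Finset.strongInduction with
  | H S ih =>
    by_cases hmin : ∀ T' : Finset α, T' ⊂ S → T' ≠ ∅ → stress rank T' < 0
    · exact ⟨S, subset_rfl, hne, hS, hmin⟩
    · push Not at hmin
      obtain ⟨T', hT'S, hT'ne, hT'⟩ := hmin
      obtain ⟨T, hTT', hT⟩ := ih T' hT'S hT'ne.ne_empty hT'
      exact ⟨T, hTT'.trans hT'S.subset, hT⟩

/-- Let `M` be a matroid of rank `r ≥ 1` with finite ground set `E` of
cardinality `2r + 1`. Then there exist at least two distinct minimal nonempty crowded
subsets of `E`. -/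
theorem exists_two_minimal_crowded {α : Type*} [Fintype α] [DecidableEq α]
    (rank : Finset α → ℕ)
    (hrank_empty : rank ∅ = 0)
    (hrank_mono : ∀ ⦃S T : Finset α⦄, S ⊆ T → rank S ≤ rank T)
    (hrank_submod : ∀ S T : Finset α, rank (S ∪ T) + rank (S ∩ T) ≤ rank S + rank T)
    (hrank_step : ∀ (S : Finset α) (e : α), rank (insert e S) ≤ rank S + 1)
    (r : ℕ) (hr : 1 ≤ r)
    (hrank_univ : rank Finset.univ = r)
    (hcard : Fintype.card α = 2 * r + 1) :
    ∃ T₁ T₂ : Finset α, T₁ ≠ T₂ ∧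
      MinNonemptyCrowded rank T₁ ∧ MinNonemptyCrowded rank T₂ := by
  have huniv_card : (Finset.univ : Finset α).card = 2 * r + 1 := hcard
  have huniv : 0 ≤ stress rank Finset.univ := by
    simp only [stress, hrank_univ, huniv_card]
    lia
  have huniv_ne : (Finset.univ : Finset α) ≠ ∅ := by
    rw [← Finset.card_ne_zero.trans Finset.nonempty_iff_ne_empty]
    lia
  obtain ⟨T₁, -, hT₁⟩ := exists_minNonemptyCrowded_subset rank huniv_ne huniv
  obtain ⟨e, he⟩ := Finset.nonempty_iff_ne_empty.2 hT₁.1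
  have herase_card : (Finset.univ.erase e).card = 2 * r := by
    rw [Finset.card_erase_of_mem (Finset.mem_univ e), huniv_card, Nat.add_sub_cancel]
  have herase : 0 ≤ stress rank (Finset.univ.erase e) := by
    have hle := hrank_mono (Finset.erase_subset e Finset.univ)
    simp only [stress, herase_card]
    lia
  have herase_ne : Finset.univ.erase e ≠ ∅ := by
    rw [← Finset.card_ne_zero.trans Finset.nonempty_iff_ne_empty]
    lia
  obtain ⟨T₂, hsub, hT₂⟩ := exists_minNonemptyCrowded_subset rank herase_ne herase
  refine ⟨T₁, T₂, ?_, hT₁, hT₂⟩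
  rintro rfl
  exact Finset.notMem_erase e Finset.univ (hsub he)
end

section
/- Let M be a matroid of rank r with finite ground set E of cardinality 2r + 1, and assume stress(S) ≤ 0 for every proper subset S ⊊ E. Let T₁, …, T_p be the minimal nonempty crowded subsets of E. Then either T_i ∩ T_j = ∅ for every pair of distinct indices i ≠ j, or T_i ∪ T_j = E for every pair of distinct indices i ≠ j. -/
/-- Stress is supermodular, because rank is submodular. -/
theorem stress_supermodular {α : Type*} [DecidableEq α] {rank : Finset α → ℕ}
    (hrank_submod : ∀ S T : Finset α, rank (S ∪ T) + rank (S ∩ T) ≤ rank S + rank T)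
    (S T : Finset α) :
    stress rank S + stress rank T ≤ stress rank (S ∪ T) + stress rank (S ∩ T) := by
  have hrank := hrank_submod S T
  have hcard := Finset.card_union_add_card_inter S T
  simp only [stress]
  omega

/-- A minimal nonempty crowded set contains no other nonempty crowded set. -/
theorem MinNonemptyCrowded.eq_of_subset {α : Type*} {rank : Finset α → ℕ} {S T : Finset α}
    (hT : MinNonemptyCrowded rank T) (hS : S ≠ ∅) (hS' : 0 ≤ stress rank S) (h : S ⊆ T) :
    S = T := by
  by_contra hne
  exact absurd (hT.2.2 S (h.ssubset_of_ne hne) hS) (not_lt.mpr hS')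

/-- If no proper subset has positive stress, two distinct minimal nonempty crowded sets that meet
cover the ground set. -/
theorem MinNonemptyCrowded.inter_eq_empty_or_union_eq_univ {α : Type*} [Fintype α]
    [DecidableEq α] {rank : Finset α → ℕ}
    (hrank_submod : ∀ S T : Finset α, rank (S ∪ T) + rank (S ∩ T) ≤ rank S + rank T)
    (hproper : ∀ S : Finset α, S ⊂ Finset.univ → stress rank S ≤ 0) {S T : Finset α}
    (hS : MinNonemptyCrowded rank S) (hT : MinNonemptyCrowded rank T) (hne : S ≠ T) :
    S ∩ T = ∅ ∨ S ∪ T = Finset.univ := by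
  by_contra! h
  have hss : S ∩ T ⊂ S := by
    refine Finset.inter_subset_left.ssubset_of_ne fun heq => hne ?_
    exact hT.eq_of_subset hS.1 hS.2.1 (Finset.inter_eq_left.mp heq)
  have hinter := hS.2.2 _ hss h.1.ne_empty
  have hunion := hproper _ ((Finset.subset_univ _).ssubset_of_ne h.2)
  have hsuper := stress_supermodular hrank_submod S T
  linarith [hS.2.1, hT.2.1]

/-- Let `M` be a matroid of rank `r` with finite ground set `E` of cardinality
`2r + 1`, and assume `stress S ≤ 0` for every proper subset `S ⊊ E`.  Then either the minimal
nonempty crowded subsets are pairwise disjoint, or the union of any two distinct ones is `E`. -/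
theorem minimal_crowded_dichotomy {α : Type*} [Fintype α] [DecidableEq α]
    (rank : Finset α → ℕ)
    (hrank_empty : rank ∅ = 0)
    (hrank_mono : ∀ ⦃S T : Finset α⦄, S ⊆ T → rank S ≤ rank T)
    (hrank_submod : ∀ S T : Finset α, rank (S ∪ T) + rank (S ∩ T) ≤ rank S + rank T)
    (hrank_step : ∀ (S : Finset α) (e : α), rank (insert e S) ≤ rank S + 1)
    (r : ℕ)
    (hrank_univ : rank Finset.univ = r)
    (hcard : Fintype.card α = 2 * r + 1)
    (hproper : ∀ S : Finset α, S ⊂ Finset.univ → stress rank S ≤ 0) :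
    (∀ T₁ T₂ : Finset α, MinNonemptyCrowded rank T₁ → MinNonemptyCrowded rank T₂ →
      T₁ ≠ T₂ → T₁ ∩ T₂ = ∅) ∨
    (∀ T₁ T₂ : Finset α, MinNonemptyCrowded rank T₁ → MinNonemptyCrowded rank T₂ →
      T₁ ≠ T₂ → T₁ ∪ T₂ = Finset.univ) := by
  have key := fun (S T : Finset α) => MinNonemptyCrowded.inter_eq_empty_or_union_eq_univ
    (S := S) (T := T) hrank_submod hproper
  by_contra! h
  obtain ⟨⟨A, B, hA, hB, hAB, hmeet⟩, C, D, hC, hD, hCD, hcover⟩ := h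
  have hdisj := (key C D hC hD hCD).resolve_right hcover
  have hunion := (key A B hA hB hAB).resolve_left hmeet.ne_empty
  have cover_left : ∀ T, MinNonemptyCrowded rank T → T ≠ A → T ∪ A = Finset.univ := by
    intro T hT hTA
    refine (key T A hT hA hTA).resolve_left fun hempty => ?_
    have hsub := (Finset.disjoint_iff_inter_eq_empty.mpr hempty).le_of_codisjoint
      (codisjoint_iff.mpr (hunion : A ⊔ B = ⊤))
    have hTB := hB.eq_of_subset hT.1 hT.2.1 hsub
    rw [hTB, Finset.inter_comm] at hempty
    exact hmeet.ne_empty hempty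
  by_cases hDA : D = A
  · subst hDA
    exact hcover (cover_left C hC hCD)
  have hDu := cover_left D hD hDA
  have hsub := (Finset.disjoint_iff_inter_eq_empty.mpr hdisj).le_of_codisjoint
    (codisjoint_iff.mpr (hDu : D ⊔ A = ⊤))
  rw [← hA.eq_of_subset hC.1 hC.2.1 hsub, Finset.union_comm] at hDu
  exact hcover hDu
end

section
/- Let E = {x₁ < x₂ < ⋯ < x_n} be a finite linearly ordered set with n ≥ 2, and let A ⊆ E with |A| = r, x₁ ∈ A and x_n ∉ A. Then the affine span over ℝ of the set of indicator vectors {e_B ∈ ℝ^E : B ⊆ E, |B| = r, A ≤_G B} is the hyperplane {z ∈ ℝ^E : Σ_{e ∈ E} z_e = r}; in particular the convex hull of these vectors has dimension n − 1, so the Schubert matroid Ω_{≤,A} is connected. -/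
/-- The Gale order on `r`-element subsets of a linearly ordered set: `A ≤_G B` iff the
`i`-th smallest element of `A` is at most the `i`-th smallest element of `B`, for all `i`. -/
def GaleLE {α : Type*} [LinearOrder α] {r : ℕ} (A B : Finset α)
    (hA : A.card = r) (hB : B.card = r) : Prop :=
  ∀ i : Fin r, (A.orderIsoOfFin hA i : α) ≤ (B.orderIsoOfFin hB i : α)

/-- If some injection of `B` into `A` never increases an element, then `A ≤_G B`. -/
theorem GaleLE.of_injOn {α : Type*} [LinearOrder α] {r : ℕ} {A B : Finset α}
    (hA : A.card = r) (hB : B.card = r) (f : α → α) (hf : ∀ x ∈ B, f x ∈ A)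
    (hinj : Set.InjOn f B) (hle : ∀ x ∈ B, f x ≤ x) : GaleLE A B hA hB := by
  intro i
  by_contra! hlt
  let b : Fin r → B := B.orderIsoOfFin hB
  let g : Fin r → Fin r := fun j => (A.orderIsoOfFin hA).symm ⟨f (b j), hf _ (b j).2⟩
  have hg : Function.Injective g := by
    intro j k h
    have h' := congrArg Subtype.val ((A.orderIsoOfFin hA).symm.injective h)
    exact (B.orderIsoOfFin hB).injective (Subtype.ext (hinj (b j).2 (b k).2 h'))
  have hmaps : (Finset.Iic i).image g ⊆ Finset.Iio i := by
    intro k hk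
    obtain ⟨j, hj, rfl⟩ := Finset.mem_image.1 hk
    rw [Finset.mem_Iio, ← (A.orderIsoOfFin hA).lt_iff_lt, OrderIso.apply_symm_apply]
    have hji : (b j : α) ≤ b i := (B.orderIsoOfFin hB).monotone (Finset.mem_Iic.1 hj)
    exact ((hle _ (b j).2).trans hji).trans_lt hlt
  have hcard := Finset.card_le_card hmaps
  rw [Finset.card_image_of_injective _ hg, Fin.card_Iic, Fin.card_Iio] at hcard
  omega

/-- Replacing an element of `A` by a larger one outside `A` goes up in the Gale order. -/
theorem GaleLE.insert_erase {α : Type*} [LinearOrder α] {r : ℕ} {A : Finset α}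
    (hA : A.card = r) {a b : α} (hb : b ∉ A) (hab : a ≤ b)
    (hB : (insert b (A.erase a)).card = r) (ha : a ∈ A) :
    GaleLE A (insert b (A.erase a)) hA hB := by
  refine GaleLE.of_injOn hA hB (fun x => if x = b then a else x) ?_ ?_ ?_
  · intro x hx
    grind
  · intro x hx y hy h
    simp only [Finset.coe_insert, Finset.coe_erase, Set.mem_insert_iff, Set.mem_sdiff,
      Finset.mem_coe, Set.mem_singleton_iff] at hx hy
    grind
  · intro x hx
    grind

/-- Let `E = {x₁ < ⋯ < x_n}` be a finite linearly ordered set with `n ≥ 2`,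
and let `A ⊆ E` with `|A| = r`, `x₁ ∈ A` and `x_n ∉ A`.  Then the affine span over `ℝ` of the
indicator vectors of the bases of the Schubert matroid `Ω_{≤,A}` (the `r`-element sets `B`
with `A ≤_G B`) is the hyperplane `{z ∈ ℝ^E : Σ_e z_e = r}`. -/
theorem schubert_affineSpan {α : Type*} [Fintype α] [LinearOrder α] [Nonempty α]
    (hn : 2 ≤ Fintype.card α)
    (r : ℕ) (A : Finset α) (hA : A.card = r)
    (hmin : Finset.univ.min' Finset.univ_nonempty ∈ A)
    (hmax : Finset.univ.max' Finset.univ_nonempty ∉ A) :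
    (affineSpan ℝ {x : α → ℝ | ∃ (B : Finset α) (hB : B.card = r),
        GaleLE A B hA hB ∧ x = fun e => if e ∈ B then (1 : ℝ) else 0} : Set (α → ℝ)) =
      {z : α → ℝ | ∑ e, z e = (r : ℝ)} := by
  set S : Set (α → ℝ) := {x : α → ℝ | ∃ (B : Finset α) (hB : B.card = r),
    GaleLE A B hA hB ∧ x = fun e => if e ∈ B then (1 : ℝ) else 0}
  set m := Finset.univ.min' (Finset.univ_nonempty (α := α))
  set M := Finset.univ.max' (Finset.univ_nonempty (α := α))
  set D := (affineSpan ℝ S).direction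
  have hAS : (fun e => if e ∈ A then (1 : ℝ) else 0) ∈ affineSpan ℝ S :=
    subset_affineSpan ℝ S ⟨A, hA, fun _ => le_rfl, rfl⟩
  have hswap : ∀ a ∈ A, ∀ b ∉ A, a ≤ b →
      (Pi.single b 1 - Pi.single a 1 : α → ℝ) ∈ D := by
    intro a ha b hb hab
    have hB : (insert b (A.erase a)).card = r := by
      rw [Finset.card_insert_of_notMem (by simp [hb]), Finset.card_erase_add_one ha, hA]
    have hBS := subset_affineSpan ℝ S
      ⟨insert b (A.erase a), hB, GaleLE.insert_erase hA hb hab hB ha, rfl⟩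
    convert AffineSubspace.vsub_mem_direction hBS hAS using 1
    ext e
    simp only [Pi.sub_apply, Pi.single_apply, vsub_eq_sub]
    grind
  have hmin_swap : ∀ e, (Pi.single e 1 - Pi.single m 1 : α → ℝ) ∈ D := by
    intro e
    by_cases he : e ∈ A
    · have h₁ := hswap e he M hmax (Finset.le_max' _ _ (Finset.mem_univ _))
      have h₂ := hswap m hmin M hmax (Finset.le_max' _ _ (Finset.mem_univ _))
      convert D.sub_mem h₂ h₁ using 1
      abel
    · exact hswap m hmin e he (Finset.min'_le _ _ (Finset.mem_univ _))
  ext z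
  simp only [SetLike.mem_coe, Set.mem_ofPred_eq]
  constructor
  · intro hz
    refine affineSpan_induction (p := fun z : α → ℝ => ∑ e, z e = (r : ℝ)) hz ?_ ?_
    · rintro x ⟨B, hB, -, rfl⟩
      simp [hB]
    · intro c u v w hu hv hw
      simp [Finset.sum_add_distrib, ← Finset.mul_sum, hu, hv, hw]
  · intro hz
    have hdir : z - (fun e => if e ∈ A then (1 : ℝ) else 0) ∈ D := by
      set w : α → ℝ := z - fun e => if e ∈ A then (1 : ℝ) else 0 with hw
      have hsum : ∑ e, w e = 0 := by simp [hw, hz, hA]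
      have hdecomp : w = ∑ e, w e • (Pi.single e 1 - Pi.single m 1 : α → ℝ) := by
        simp only [smul_sub, Finset.sum_sub_distrib, ← Finset.sum_smul, hsum, zero_smul, sub_zero]
        exact pi_eq_sum_univ' w
      rw [hdecomp]
      exact D.sum_mem fun e _ => D.smul_mem _ (hmin_swap e)
    simpa using AffineSubspace.vadd_mem_of_mem_direction hdir hAS
end

section
/- Let E be a finite set with |E| = n, let ∅ = S₀ ⊊ S₁ ⊊ ⋯ ⊊ S_k = E be a chain of subsets, and let a₀, a₁, …, a_k be nonnegative integers with a₀ = 0, a_k = r, and a_{i−1} ≤ a_i ≤ a_{i−1} + |S_i ∖ S_{i−1}| for all i. Then the convex hull in ℝ^E of the indicator vectors {e_B : B ⊆ E, |B| = r, and |B ∩ S_i| ≤ a_i for i = 1, …, k−1} equals Δ(r,E) ∩ ⋂_{i=1}^{k−1} {x ∈ ℝ^E : Σ_{e ∈ S_i} x_e ≤ a_i}, where Δ(r,E) is the hypersimplex. -/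
/-- The part of the hypersimplex `Δ(r, α)` cut out by the inequalities `∑ e ∈ S i, x e ≤ a i`. -/
def truncatedHypersimplex {α ι : Type*} [Fintype α] (r : ℕ) (S : ι → Finset α) (a : ι → ℕ) :
    Set (α → ℝ) :=
  {x | (∀ e, 0 ≤ x e ∧ x e ≤ 1) ∧ ∑ e, x e = (r : ℝ) ∧ ∀ i, ∑ e ∈ S i, x e ≤ (a i : ℝ)}

theorem convex_truncatedHypersimplex {α ι : Type*} [Fintype α] (r : ℕ) (S : ι → Finset α)
    (a : ι → ℕ) : Convex ℝ (truncatedHypersimplex r S a) := by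
  rintro x ⟨hx, hxr, hxa⟩ y ⟨hy, hyr, hya⟩ s t hs ht hst
  refine ⟨fun e => ⟨?_, ?_⟩, ?_, fun i => ?_⟩
  · have := mul_nonneg hs (hx e).1
    have := mul_nonneg ht (hy e).1
    simp only [Pi.add_apply, Pi.smul_apply, smul_eq_mul]
    linarith
  · have := mul_le_mul_of_nonneg_left (hx e).2 hs
    have := mul_le_mul_of_nonneg_left (hy e).2 ht
    simp only [Pi.add_apply, Pi.smul_apply, smul_eq_mul]
    linarith
  · simp only [Pi.add_apply, Pi.smul_apply, smul_eq_mul, Finset.sum_add_distrib,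
      ← Finset.mul_sum, hxr, hyr]
    rw [← add_mul, hst, one_mul]
  · have := mul_le_mul_of_nonneg_left (hxa i) hs
    have := mul_le_mul_of_nonneg_left (hya i) ht
    simp only [Pi.add_apply, Pi.smul_apply, smul_eq_mul, Finset.sum_add_distrib,
      ← Finset.mul_sum]
    calc _ ≤ s * (a i : ℝ) + t * (a i : ℝ) := by linarith
      _ = a i := by rw [← add_mul, hst, one_mul]

theorem isCompact_truncatedHypersimplex {α ι : Type*} [Fintype α] (r : ℕ) (S : ι → Finset α)
    (a : ι → ℕ) : IsCompact (truncatedHypersimplex r S a) := by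
  refine (isCompact_Icc (a := (0 : α → ℝ)) (b := 1)).of_isClosed_subset ?_
    fun x hx => ⟨fun e => (hx.1 e).1, fun e => (hx.1 e).2⟩
  simp only [truncatedHypersimplex, Set.ofPred_and, Set.ofPred_forall]
  refine .inter (isClosed_iInter fun e => .inter ?_ ?_) (.inter ?_ (isClosed_iInter fun i => ?_))
  · exact isClosed_le (by fun_prop) (by fun_prop)
  · exact isClosed_le (by fun_prop) (by fun_prop)
  · exact isClosed_eq (by fun_prop) (by fun_prop)
  · exact isClosed_le (by fun_prop) (by fun_prop)

/-- The sum of a `0/1`-valued function counts the points where it equals `1`. -/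
theorem sum_eq_card_filter_eq_one {α : Type*} (T : Finset α) (x : α → ℝ)
    (h : ∀ e ∈ T, x e = 0 ∨ x e = 1) :
    ∑ e ∈ T, x e = ((T.filter fun e => x e = 1).card : ℝ) := by
  rw [Finset.card_filter, Nat.cast_sum]
  refine Finset.sum_congr rfl fun e he => ?_
  rcases h e he with h | h <;> simp [h]

/-- A `[0, 1]`-valued function with integral sum cannot have exactly one fractional value. -/
theorem exists_ne_fractional {α : Type*} [DecidableEq α] (T : Finset α) (x : α → ℝ)
    (hx : ∀ e, 0 ≤ x e ∧ x e ≤ 1) (m : ℕ) (hsum : ∑ e ∈ T, x e = (m : ℝ)) {p : α} (hp : p ∈ T)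
    (hp0 : 0 < x p) (hp1 : x p < 1) : ∃ q ∈ T, q ≠ p ∧ 0 < x q ∧ x q < 1 := by
  by_contra! hcon
  have hint : ∀ e ∈ T.erase p, x e = 0 ∨ x e = 1 := fun e he => by
    rcases (hx e).1.eq_or_lt with h | h
    · exact .inl h.symm
    · exact .inr (le_antisymm (hx e).2
        (hcon e (Finset.mem_of_mem_erase he) (Finset.ne_of_mem_erase he) h))
  rw [← Finset.add_sum_erase T x hp, sum_eq_card_filter_eq_one _ x hint] at hsum
  set c := ((T.erase p).filter fun e => x e = 1).card
  have h1 : c < m := by exact_mod_cast (by linarith : (c : ℝ) < m)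
  have h2 : m < c + 1 := by exact_mod_cast (by linarith : (m : ℝ) < c + 1)
  omega

/-- An extreme point of the hypersimplex truncated along a chain has `0/1` coordinates. -/
theorem eq_zero_or_one_of_mem_extremePoints {α ι : Type*} [Fintype α] [DecidableEq α] [Finite ι]
    (r : ℕ) (S : ι → Finset α) (a : ι → ℕ) (hS : ∀ i j, S i ⊆ S j ∨ S j ⊆ S i) {x : α → ℝ}
    (hx : x ∈ (truncatedHypersimplex r S a).extremePoints ℝ) (e : α) : x e = 0 ∨ x e = 1 := by
  obtain ⟨⟨hx01, hxr, hxa⟩, hext⟩ := hx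
  by_contra! he
  have he0 : 0 < x e := lt_of_le_of_ne (hx01 e).1 he.1.symm
  have he1 : x e < 1 := lt_of_le_of_ne (hx01 e).2 he.2
  let tight : Finset α → Prop := fun T =>
    (T = Finset.univ ∨ ∃ i, T = S i ∧ ∑ e ∈ T, x e = (a i : ℝ)) ∧ ∃ p ∈ T, 0 < x p ∧ x p < 1
  obtain ⟨T, ⟨hT, p, hpT, hp0, hp1⟩, hTmin⟩ : ∃ T, tight T ∧ ∀ U, tight U → ¬ U < T :=
    wellFounded_lt.has_min {T | tight T} ⟨Finset.univ, .inl rfl, e, Finset.mem_univ e, he0, he1⟩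
  obtain ⟨m, hm⟩ : ∃ m : ℕ, ∑ e ∈ T, x e = (m : ℝ) := by
    rcases hT with rfl | ⟨i, -, hi⟩
    exacts [⟨r, hxr⟩, ⟨a i, hi⟩]
  obtain ⟨q, hqT, hqp, hq0, hq1⟩ := exists_ne_fractional T x hx01 m hm hpT hp0 hp1
  -- A tight constraint does not separate `p` from `q`.
  have hsep : ∀ i, ∑ e ∈ S i, x e = (a i : ℝ) → (p ∈ S i ↔ q ∈ S i) := by
    intro i hi
    by_cases hsub : T ⊆ S i
    · exact iff_of_true (hsub hpT) (hsub hqT)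
    · have hlt : S i < T := by
        refine Finset.ssubset_iff_subset_ne.2 ⟨?_, fun h => hsub h.ge⟩
        rcases hT with rfl | ⟨j, rfl, -⟩
        · exact Finset.subset_univ _
        · exact (hS i j).resolve_right hsub
      exact iff_of_false (fun h => hTmin _ ⟨.inr ⟨i, rfl, hi⟩, p, h, hp0, hp1⟩ hlt)
        (fun h => hTmin _ ⟨.inr ⟨i, rfl, hi⟩, q, h, hq0, hq1⟩ hlt)
  let v : α → ℝ := Pi.single p 1 - Pi.single q 1
  have hsumv : ∀ U : Finset α,
      ∑ e ∈ U, v e = (if p ∈ U then 1 else 0) - (if q ∈ U then 1 else 0) := by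
    intro U
    simp [v, Finset.sum_sub_distrib, Pi.single_apply]
  have hv : ∀ e, v e ≠ 0 → 0 < x e ∧ x e < 1 := by
    intro e hve
    by_cases hep : e = p
    · exact hep ▸ ⟨hp0, hp1⟩
    · by_cases heq : e = q
      · exact heq ▸ ⟨hq0, hq1⟩
      · simp [v, hep, heq] at hve
  have hmem : ∀ᶠ t : ℝ in nhds 0, x + t • v ∈ truncatedHypersimplex r S a := by
    refine .and (Filter.eventually_all.2 fun e => ?_) (.and (.of_forall fun t => ?_)
      (Filter.eventually_all.2 fun i => ?_))
    · by_cases hve : v e = 0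
      · exact .of_forall fun t => by simpa [hve] using hx01 e
      · have hc : Filter.Tendsto (fun t : ℝ => (x + t • v) e) (nhds 0) (nhds (x e)) :=
          Continuous.tendsto' (by simp only [Pi.add_apply, Pi.smul_apply]; fun_prop) _ _ (by simp)
        exact (hc.eventually (Icc_mem_nhds (hv e hve).1 (hv e hve).2))
    · simp [Finset.sum_add_distrib, ← Finset.mul_sum, hsumv, hxr]
    · rcases (hxa i).eq_or_lt with h | h
      · refine .of_forall fun t => ?_
        simp [Finset.sum_add_distrib, ← Finset.mul_sum, hsumv, h, hsep i h]
      · have hc : Filter.Tendsto (fun t : ℝ => ∑ e ∈ S i, (x + t • v) e) (nhds 0)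
            (nhds (∑ e ∈ S i, x e)) :=
          Continuous.tendsto' (by simp only [Pi.add_apply, Pi.smul_apply]; fun_prop) _ _ (by simp)
        exact hc.eventually (Iic_mem_nhds h)
  have hmem' : ∀ᶠ t : ℝ in nhds 0, x + (-t) • v ∈ truncatedHypersimplex r S a :=
    (Continuous.tendsto' continuous_neg (0 : ℝ) 0 neg_zero).eventually hmem
  obtain ⟨t, ⟨ht, ht'⟩, htpos⟩ :=
    (((hmem.and hmem').filter_mono nhdsWithin_le_nhds).and
      (self_mem_nhdsWithin (a := (0 : ℝ)) (s := Set.Ioi 0))).exists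
  have heq : x + t • v = x := by
    refine hext ht ht' ⟨1 / 2, 1 / 2, by norm_num, by norm_num, by norm_num, ?_⟩
    ext e
    simp only [Pi.add_apply, Pi.smul_apply, smul_eq_mul]
    ring
  have := congrFun heq p
  simp [v, hqp.symm] at this
  exact (Set.mem_Ioi.1 htpos).ne' this

/-- The hypersimplex truncated along a chain is the convex hull of its `0/1` points. -/
theorem convexHull_indicators_eq_truncatedHypersimplex {α ι : Type*} [Fintype α] [DecidableEq α]
    [Finite ι] (r : ℕ) (S : ι → Finset α) (a : ι → ℕ) (hS : ∀ i j, S i ⊆ S j ∨ S j ⊆ S i) :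
    convexHull ℝ {x : α → ℝ | ∃ B : Finset α, B.card = r ∧ (∀ i, (B ∩ S i).card ≤ a i) ∧
      x = fun e => if e ∈ B then (1 : ℝ) else 0} = truncatedHypersimplex r S a := by
  set V := {x : α → ℝ | ∃ B : Finset α, B.card = r ∧ (∀ i, (B ∩ S i).card ≤ a i) ∧
      x = fun e => if e ∈ B then (1 : ℝ) else 0}
  apply Set.Subset.antisymm
  · refine convexHull_min ?_ (convex_truncatedHypersimplex r S a)
    rintro _ ⟨B, hB, hBa, rfl⟩
    refine ⟨fun e => ?_, by simp [hB], fun i => ?_⟩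
    · dsimp only
      split_ifs <;> norm_num
    · rw [Finset.sum_ite_mem, Finset.sum_const, nsmul_one, Finset.inter_comm]
      exact_mod_cast hBa i
  · have hfin : V.Finite := by
      refine (Set.finite_range fun (B : Finset α) (e : α) =>
        if e ∈ B then (1 : ℝ) else 0).subset ?_
      rintro _ ⟨B, -, -, rfl⟩
      exact ⟨B, rfl⟩
    rw [← closure_convexHull_extremePoints (isCompact_truncatedHypersimplex r S a)
      (convex_truncatedHypersimplex r S a)]
    refine closure_minimal (convexHull_mono fun x hx => ?_) (hfin.isClosed_convexHull ℝ)
    have h01 := eq_zero_or_one_of_mem_extremePoints r S a hS hx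
    obtain ⟨⟨-, hxr, hxa⟩, -⟩ := hx
    refine ⟨Finset.univ.filter fun e => x e = 1, ?_, fun i => ?_, ?_⟩
    · rw [sum_eq_card_filter_eq_one _ x fun e _ => h01 e] at hxr
      exact_mod_cast hxr
    · have := hxa i
      rw [sum_eq_card_filter_eq_one _ x fun e _ => h01 e] at this
      rw [Finset.filter_inter, Finset.univ_inter]
      exact_mod_cast this
    · ext e
      rcases h01 e with h | h <;> simp [h]

/-- Let `E` be a finite set with `|E| = n`, let
`∅ = S₀ ⊊ S₁ ⊊ ⋯ ⊊ S_k = E` be a chain of subsets, and let `a₀, …, a_k` be nonnegative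
integers with `a₀ = 0`, `a_k = r` and `a_{i-1} ≤ a_i ≤ a_{i-1} + |S_i \ S_{i-1}|`.
Then the convex hull of the indicator vectors of the bases of the Schubert matroid
`Ω_{S•,a}` (the `r`-element sets `B` with `|B ∩ S_i| ≤ a_i` for `1 ≤ i ≤ k-1`) is the
intersection of the hypersimplex `Δ(r,E)` with the halfspaces `Σ_{e ∈ S_i} x_e ≤ a_i`. -/
theorem schubert_polytope_eq {α : Type*} [Fintype α] [DecidableEq α]
    (n r k : ℕ) (hn : Fintype.card α = n)
    (S : Fin (k + 1) → Finset α)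
    (hS0 : S 0 = ∅) (hSk : S (Fin.last k) = Finset.univ)
    (hSmono : StrictMono S)
    (a : Fin (k + 1) → ℕ)
    (ha0 : a 0 = 0) (hak : a (Fin.last k) = r)
    (hastep : ∀ i : Fin k,
      a i.castSucc ≤ a i.succ ∧ a i.succ ≤ a i.castSucc + (S i.succ \ S i.castSucc).card) :
    convexHull ℝ {x : α → ℝ | ∃ B : Finset α, B.card = r ∧
        (∀ i : Fin (k + 1), i ≠ 0 → i ≠ Fin.last k → (B ∩ S i).card ≤ a i) ∧
        x = fun e => if e ∈ B then (1 : ℝ) else 0} =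
      {x : α → ℝ | (∀ e, 0 ≤ x e ∧ x e ≤ 1) ∧ ∑ e, x e = (r : ℝ)} ∩
      {x : α → ℝ | ∀ i : Fin (k + 1), i ≠ 0 → i ≠ Fin.last k →
        ∑ e ∈ S i, x e ≤ (a i : ℝ)} := by
  have key := convexHull_indicators_eq_truncatedHypersimplex r
    (fun i : {i : Fin (k + 1) // i ≠ 0 ∧ i ≠ Fin.last k} => S i) (fun i => a i)
    fun i j => (le_total i.1 j.1).imp (fun h => hSmono.monotone h) (fun h => hSmono.monotone h)
  simp only [truncatedHypersimplex, Subtype.forall, and_imp] at key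
  rw [key]
  ext x
  simp only [Set.mem_ofPred_eq, Set.mem_inter_iff, and_assoc]
end

section
/- Let M be a matroid of rank r with finite ground set E, |E| = n. Then for every x ∈ ℝ^E, 1_{Δ(M)}(x) = Σ_{S•} (−1)^{n−k} · 1_{Δ(Ω_{S•,M})}(x), where the sum is over all chains S• : ∅ = S₀ ⊊ S₁ ⊊ ⋯ ⊊ S_k = E of subsets of E (of any length k). -/
/-- The base polytope of a matroid of rank `r` with rank function `rank`:
`{x : Σ_{e ∈ S} x_e ≤ rank S for all S, and Σ_e x_e = r}`. -/
def basePolytope {α : Type*} [Fintype α] (rank : Finset α → ℕ) (r : ℕ) : Set (α → ℝ) :=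
  {x | (∀ S : Finset α, ∑ e ∈ S, x e ≤ (rank S : ℝ)) ∧ ∑ e, x e = (r : ℝ)}

/-- The hypersimplex `Δ(r, E)`. -/
def hypersimplex (α : Type*) [Fintype α] (r : ℕ) : Set (α → ℝ) :=
  {x | (∀ e, 0 ≤ x e ∧ x e ≤ 1) ∧ ∑ e, x e = (r : ℝ)}

/-- The base polytope `Δ(Ω_{S•,M})` of the Schubert matroid associated to a chain whose
set of intermediate members is `C`:  the points of the hypersimplex satisfying
`Σ_{e ∈ A} x_e ≤ rank A` for each member `A` of the chain. -/
def schubertPolytope {α : Type*} [Fintype α] (rank : Finset α → ℕ) (r : ℕ)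
    (C : Finset (Finset α)) : Set (α → ℝ) :=
  {x | x ∈ hypersimplex α r ∧ ∀ A ∈ C, ∑ e ∈ A, x e ≤ (rank A : ℝ)}

/-- Totally ordered families of proper nonempty subsets. -/
def properChains (α : Type*) [Fintype α] [DecidableEq α] : Finset (Finset (Finset α)) :=
  Finset.univ.filter (fun C : Finset (Finset α) =>
    (∀ A ∈ C, A ≠ ∅ ∧ A ≠ Finset.univ) ∧
    (∀ A ∈ C, ∀ B ∈ C, A ⊆ B ∨ B ⊆ A))

section Chains

variable {α : Type*} [DecidableEq α]

/-- The union of the members of `C` that do not contain `A`. -/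
def supNotContaining (A : Finset α) (C : Finset (Finset α)) : Finset α :=
  (C.filter (fun S => ¬ A ⊆ S)).sup id

/-- Add `supNotContaining A C ∪ A` to `C` if it is absent, remove it if it is present. -/
def toggle (A : Finset α) (C : Finset (Finset α)) : Finset (Finset α) :=
  symmDiff C {supNotContaining A C ∪ A}

theorem mem_toggle {A S : Finset α} {C : Finset (Finset α)} :
    S ∈ toggle A C ↔ (S ∈ C ∧ S ≠ supNotContaining A C ∪ A) ∨
      (S = supNotContaining A C ∪ A ∧ S ∉ C) := by
  simp [toggle, Finset.mem_symmDiff]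

theorem supNotContaining_toggle (A : Finset α) (C : Finset (Finset α)) :
    supNotContaining A (toggle A C) = supNotContaining A C := by
  have h : (toggle A C).filter (fun S => ¬ A ⊆ S) = C.filter (fun S => ¬ A ⊆ S) := by
    ext S
    simp only [Finset.mem_filter, mem_toggle]
    constructor
    · rintro ⟨h | h, hS⟩
      · exact ⟨h.1, hS⟩
      · exact absurd (h.1 ▸ Finset.subset_union_right) hS
    · rintro ⟨h, hS⟩
      exact ⟨Or.inl ⟨h, fun h' => hS (h' ▸ Finset.subset_union_right)⟩, hS⟩
  rw [supNotContaining, h, supNotContaining]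

theorem toggle_toggle (A : Finset α) (C : Finset (Finset α)) : toggle A (toggle A C) = C := by
  rw [toggle, supNotContaining_toggle, toggle, symmDiff_symmDiff_cancel_right]

theorem toggle_ne (A : Finset α) (C : Finset (Finset α)) : toggle A C ≠ C := by
  simp [toggle, symmDiff_eq_left]

theorem neg_one_pow_card_toggle (A : Finset α) (C : Finset (Finset α)) :
    (-1 : ℤ) ^ C.card + (-1 : ℤ) ^ (toggle A C).card = 0 := by
  set U := supNotContaining A C ∪ A with hU
  by_cases h : U ∈ C
  · have : toggle A C = C.erase U := by
      ext S; rw [mem_toggle, Finset.mem_erase]; grind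
    rw [this, ← Finset.card_erase_add_one h, pow_succ]; ring
  · have : toggle A C = insert U C := by
      ext S; rw [mem_toggle, Finset.mem_insert]; grind
    rw [this, Finset.card_insert_of_notMem h, pow_succ]; ring

theorem sum_neg_one_pow_card_eq_zero_of_toggle (A : Finset α)
    (F : Finset (Finset (Finset α))) (hF : ∀ C ∈ F, toggle A C ∈ F) :
    ∑ C ∈ F, (-1 : ℤ) ^ C.card = 0 :=
  Finset.sum_involution (fun C _ => toggle A C)
    (fun C _ => neg_one_pow_card_toggle A C) (fun C _ _ => toggle_ne A C)
    hF (fun C _ => toggle_toggle A C)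

theorem sup_mem_of_total {C : Finset (Finset α)} (hne : C.Nonempty)
    (hC : ∀ S ∈ C, ∀ T ∈ C, S ⊆ T ∨ T ⊆ S) : C.sup id ∈ C := by
  obtain ⟨M, hM, hmax⟩ := C.exists_max_image Finset.card hne
  have : C.sup id = M := by
    refine le_antisymm (Finset.sup_le fun S hS => ?_) (Finset.le_sup (f := id) hM)
    rcases hC S hS M hM with h | h
    · exact h
    · exact (Finset.eq_of_subset_of_card_le h (hmax S hS)).ge
  rwa [this]

theorem supNotContaining_eq_empty_or_mem {A : Finset α} {C : Finset (Finset α)}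
    (hC : ∀ S ∈ C, ∀ T ∈ C, S ⊆ T ∨ T ⊆ S) :
    supNotContaining A C = ∅ ∨ (supNotContaining A C ∈ C ∧ ¬ A ⊆ supNotContaining A C) := by
  rcases (C.filter (fun S => ¬ A ⊆ S)).eq_empty_or_nonempty with h | h
  · left; rw [supNotContaining, h]; rfl
  · right
    exact Finset.mem_filter.1 (sup_mem_of_total h fun S hS T hT =>
      hC S (Finset.mem_filter.1 hS).1 T (Finset.mem_filter.1 hT).1)

theorem toggle_total {A : Finset α} {C : Finset (Finset α)}
    (hC : ∀ S ∈ C, ∀ T ∈ C, S ⊆ T ∨ T ⊆ S) :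
    ∀ S ∈ toggle A C, ∀ T ∈ toggle A C, S ⊆ T ∨ T ⊆ S := by
  have key : ∀ S ∈ C, S ⊆ supNotContaining A C ∪ A ∨ supNotContaining A C ∪ A ⊆ S := by
    intro S hS
    by_cases hA : A ⊆ S
    · right
      refine Finset.union_subset ?_ hA
      rcases supNotContaining_eq_empty_or_mem (A := A) hC with h | ⟨h, h'⟩
      · simp [h]
      · rcases hC S hS _ h with h1 | h1
        · exact absurd (hA.trans h1) h'
        · exact h1
    · left
      exact (Finset.le_sup (f := id) (Finset.mem_filter.2 ⟨hS, hA⟩)).trans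
        Finset.subset_union_left
  intro S hS T hT
  rw [mem_toggle] at hS hT
  rcases hS with ⟨hS, -⟩ | ⟨rfl, -⟩ <;> rcases hT with ⟨hT, -⟩ | ⟨rfl, -⟩
  · exact hC S hS T hT
  · exact key S hS
  · exact (key T hT).symm
  · exact Or.inl subset_rfl

variable [Fintype α]

theorem mem_properChains {C : Finset (Finset α)} :
    C ∈ properChains α ↔ (∀ A ∈ C, A ≠ ∅ ∧ A ≠ Finset.univ) ∧
      (∀ A ∈ C, ∀ B ∈ C, A ⊆ B ∨ B ⊆ A) := by
  simp [properChains]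

theorem properChains_mono {C D : Finset (Finset α)} (hDC : D ⊆ C) (hC : C ∈ properChains α) :
    D ∈ properChains α := by
  rw [mem_properChains] at hC ⊢
  exact ⟨fun A hA => hC.1 A (hDC hA), fun A hA B hB => hC.2 A (hDC hA) B (hDC hB)⟩

theorem card_le_of_mem_properChains {C : Finset (Finset α)} (hC : C ∈ properChains α) :
    C.card ≤ Fintype.card α - 1 := by
  rw [mem_properChains] at hC
  have h : C.card ≤ (Finset.Ioo 0 (Fintype.card α)).card := by
    refine Finset.card_le_card_of_injOn Finset.card (fun A hA => ?_) (fun A hA B hB h => ?_)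
    · have := hC.1 A hA
      simp only [Finset.coe_Ioo, Set.mem_Ioo]
      exact ⟨Finset.card_pos.2 (Finset.nonempty_iff_ne_empty.2 this.1),
        (Finset.card_lt_iff_ne_univ A).2 this.2⟩
    · rcases hC.2 A hA B hB with h' | h'
      · exact Finset.eq_of_subset_of_card_le h' h.ge
      · exact (Finset.eq_of_subset_of_card_le h' h.le).symm
  simpa using h

/-- A chain of proper nonempty subsets that is not of maximal length admits a point `a` such
that, for `B` the smallest member containing `a` (or the whole set), `B.erase a` can be added. -/
theorem exists_erase_insertable {D : Finset (Finset α)} (hD : D ∈ properChains α)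
    (hcard : D.card < Fintype.card α - 1) :
    ∃ a : α, ∃ B ∈ insert Finset.univ D, a ∈ B ∧ (∀ S ∈ D, a ∈ S → B ⊆ S) ∧
      B.erase a ∉ insert ∅ D := by
  rw [mem_properChains] at hD
  have hmin : ∀ a : α, ∃ B ∈ insert Finset.univ D, a ∈ B ∧
      ∀ S ∈ insert Finset.univ D, a ∈ S → B ⊆ S := by
    intro a
    obtain ⟨B, hB, hBmin⟩ := ((insert Finset.univ D).filter (fun S => a ∈ S)).exists_min_image
      Finset.card ⟨Finset.univ, by simp⟩
    rw [Finset.mem_filter] at hB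
    refine ⟨B, hB.1, hB.2, fun S hS haS => ?_⟩
    have hle := hBmin S (Finset.mem_filter.2 ⟨hS, haS⟩)
    have htot : B ⊆ S ∨ S ⊆ B := by
      rcases Finset.mem_insert.1 hS with rfl | hS
      · exact Or.inl (Finset.subset_univ _)
      rcases Finset.mem_insert.1 hB.1 with h | hB
      · exact Or.inr (h ▸ Finset.subset_univ _)
      exact hD.2 B hB S hS
    rcases htot with h | h
    · exact h
    · exact (Finset.eq_of_subset_of_card_le h hle).ge
  choose B hBmem haB hBmin using hmin
  by_contra! hcon
  have herase : ∀ a, (B a).erase a ∈ insert ∅ D := fun a =>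
    hcon a (B a) (hBmem a) (haB a) (fun S hS => hBmin a S (Finset.mem_insert_of_mem hS))
  have hinj : Function.Injective B := by
    intro a b hab
    by_contra hne
    have hb : b ∈ (B a).erase a := Finset.mem_erase.2 ⟨Ne.symm hne, hab ▸ haB b⟩
    rcases Finset.mem_insert.1 (herase a) with h | h
    · simp [h] at hb
    · have := hBmin b _ (Finset.mem_insert_of_mem h) hb
      rw [← hab] at this
      exact Finset.notMem_erase a _ (this (haB a))
  have h1 : Fintype.card α ≤ (insert Finset.univ D).card := by
    rw [← Finset.card_univ]
    exact Finset.card_le_card_of_injOn B (fun a _ => hBmem a) hinj.injOn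
  have h2 := Finset.card_insert_le Finset.univ D
  omega

theorem sum_properChains_superset {D : Finset (Finset α)} (hD : D ∈ properChains α) :
    ∑ C ∈ (properChains α).filter (fun C => D ⊆ C), (-1 : ℤ) ^ C.card =
      (-1) ^ (Fintype.card α - 1) := by
  induction hm : Fintype.card α - 1 - D.card using Nat.strong_induction_on generalizing D with
  | _ m ih =>
    have hDle := card_le_of_mem_properChains hD
    by_cases hcard : Fintype.card α - 1 ≤ D.card
    · have hsing : (properChains α).filter (fun C => D ⊆ C) = {D} := by
        ext C
        simp only [Finset.mem_filter, Finset.mem_singleton]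
        constructor
        · rintro ⟨hC, hDC⟩
          exact (Finset.eq_of_subset_of_card_le hDC
            ((card_le_of_mem_properChains hC).trans hcard)).symm
        · rintro rfl
          exact ⟨hD, subset_rfl⟩
      rw [hsing, Finset.sum_singleton, le_antisymm hDle hcard]
    · obtain ⟨a, B, hB, haB, hBmin, hBe⟩ := exists_erase_insertable hD (not_le.1 hcard)
      rw [Finset.mem_insert, not_or] at hBe
      have hBS : ∀ S ∈ D, S ⊆ B ∨ B ⊆ S := fun S hS => by
        rcases Finset.mem_insert.1 hB with rfl | hB
        · exact Or.inl (Finset.subset_univ _)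
        · exact (mem_properChains.1 hD).2 S hS B hB
      have hzero : ∑ C ∈ ((properChains α).filter (fun C => D ⊆ C)).filter
          (fun C => ¬ B.erase a ∈ C), (-1 : ℤ) ^ C.card = 0 := by
        refine sum_neg_one_pow_card_eq_zero_of_toggle {a} _ fun C hC => ?_
        simp only [Finset.mem_filter] at hC ⊢
        obtain ⟨⟨hC, hDC⟩, hBC⟩ := hC
        have hC' := mem_properChains.1 hC
        set T := supNotContaining {a} C with hT
        have hTa : a ∉ T := by
          rcases supNotContaining_eq_empty_or_mem (A := {a}) hC'.2 with h | h
          · rw [hT, h]; simp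
          · simpa using h.2
        have hTne : T ≠ B.erase a := by
          rcases supNotContaining_eq_empty_or_mem (A := {a}) hC'.2 with h | h
          · rw [hT, h]; exact Ne.symm hBe.1
          · exact fun h' => hBC (h' ▸ h.1)
        have hTB : T ⊆ B := by
          rcases supNotContaining_eq_empty_or_mem (A := {a}) hC'.2 with h | h
          · rw [hT, h]; simp
          · rcases Finset.mem_insert.1 hB with rfl | hB
            · exact Finset.subset_univ _
            · rcases hC'.2 _ h.1 B (hDC hB) with h' | h'
              · exact h'
              · exact absurd (h' haB) hTa
        have hBT : ¬ B ⊆ T ∪ {a} := fun h => by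
          refine hTne (subset_antisymm (Finset.subset_erase.2 ⟨hTB, hTa⟩) fun b hb => ?_)
          have := h (Finset.mem_of_mem_erase hb)
          simpa [Finset.ne_of_mem_erase hb] using this
        refine ⟨⟨mem_properChains.2 ⟨fun S hS => ?_, toggle_total hC'.2⟩, fun S hS => ?_⟩, ?_⟩
        · rcases mem_toggle.1 hS with h | h
          · exact hC'.1 S h.1
          · rw [h.1]
            refine ⟨Finset.Nonempty.ne_empty ⟨a, by simp⟩, fun h' => hBT ?_⟩
            rw [hT, h']
            exact Finset.subset_univ _
        · refine mem_toggle.2 (Or.inl ⟨hDC hS, fun h => hBT ?_⟩)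
          rw [hT, ← h]
          exact hBmin S hS (by rw [h]; simp)
        · rw [mem_toggle]
          rintro (h | h)
          · exact hBC h.1
          · have : a ∈ B.erase a := by rw [h.1]; simp
            simp at this
      have hins : insert (B.erase a) D ∈ properChains α := by
        rw [mem_properChains] at hD ⊢
        have hcomp : ∀ S ∈ D, S ⊆ B.erase a ∨ B.erase a ⊆ S := fun S hS => by
          by_cases haS : a ∈ S
          · exact Or.inr ((Finset.erase_subset _ _).trans (hBmin S hS haS))
          · rcases hBS S hS with h | h
            · exact Or.inl (Finset.subset_erase.2 ⟨h, haS⟩)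
            · exact absurd (h haB) haS
        refine ⟨fun S hS => ?_, fun S hS S' hS' => ?_⟩
        · rcases Finset.mem_insert.1 hS with rfl | hS
          · refine ⟨hBe.1, fun h => ?_⟩
            have := Finset.mem_univ a
            rw [← h] at this
            simp at this
          · exact hD.1 S hS
        · rcases Finset.mem_insert.1 hS with rfl | hS <;>
            rcases Finset.mem_insert.1 hS' with rfl | hS'
          · exact Or.inl subset_rfl
          · exact (hcomp S' hS').symm
          · exact hcomp S hS
          · exact hD.2 S hS S' hS'
      have hfil : ((properChains α).filter (fun C => D ⊆ C)).filter (fun C => B.erase a ∈ C) =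
          (properChains α).filter (fun C => insert (B.erase a) D ⊆ C) := by
        ext C
        simp only [Finset.mem_filter, Finset.insert_subset_iff]
        tauto
      rw [← Finset.sum_filter_add_sum_filter_not _ (fun C => B.erase a ∈ C), hzero, add_zero,
        hfil]
      refine ih _ ?_ hins rfl
      rw [Finset.card_insert_of_notMem hBe.2]
      omega

/-- Alexander duality for Euler characteristics in the Boolean lattice. -/
theorem sum_properChains_disjoint (Q : Finset (Finset α)) :
    ∑ C ∈ (properChains α).filter (fun C => Disjoint C Q), (-1 : ℤ) ^ C.card =
      (-1) ^ (Fintype.card α - 1) *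
        ∑ D ∈ (properChains α).filter (fun D => D ⊆ Q), (-1 : ℤ) ^ D.card := by
  have h1 : ∀ C : Finset (Finset α), (if Disjoint C Q then (-1 : ℤ) ^ C.card else 0) =
      ∑ D ∈ (C ∩ Q).powerset, (-1 : ℤ) ^ C.card * (-1 : ℤ) ^ D.card := fun C => by
    rw [← Finset.mul_sum, Finset.sum_powerset_neg_one_pow_card]
    simp [Finset.disjoint_iff_inter_eq_empty]
  rw [Finset.sum_filter, Finset.sum_congr rfl fun C _ => h1 C, Finset.mul_sum,
    Finset.sum_comm' (t' := (properChains α).filter (fun D => D ⊆ Q))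
      (s' := fun D => (properChains α).filter (fun C => D ⊆ C))]
  · refine Finset.sum_congr rfl fun D hD => ?_
    rw [← Finset.sum_mul, sum_properChains_superset (Finset.mem_filter.1 hD).1]
  · intro C D
    simp only [Finset.mem_powerset, Finset.subset_inter_iff, Finset.mem_filter]
    constructor
    · rintro ⟨hC, hDC, hDQ⟩
      exact ⟨⟨hC, hDC⟩, properChains_mono hDC hC, hDQ⟩
    · rintro ⟨⟨hC, hDC⟩, -, hDQ⟩
      exact ⟨hC, hDC, hDQ⟩

theorem sum_properChains_subset_eq_zero {Q : Finset (Finset α)} {A : Finset α} (hA : A ∈ Q)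
    (hQ : ∀ S ∈ Q, S ≠ ∅ ∧ S ≠ Finset.univ) (hunion : ∀ S ∈ Q, S ∪ A ∈ Q) :
    ∑ D ∈ (properChains α).filter (fun D => D ⊆ Q), (-1 : ℤ) ^ D.card = 0 := by
  refine sum_neg_one_pow_card_eq_zero_of_toggle A _ fun D hD => ?_
  simp only [Finset.mem_filter] at hD ⊢
  obtain ⟨hD, hDQ⟩ := hD
  have hD' := mem_properChains.1 hD
  have hmem : supNotContaining A D ∪ A ∈ Q := by
    rcases supNotContaining_eq_empty_or_mem (A := A) hD'.2 with h | h
    · simpa [h] using hA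
    · exact hunion _ (hDQ h.1)
  have hsub : toggle A D ⊆ Q := fun S hS => by
    rcases mem_toggle.1 hS with h | h
    · exact hDQ h.1
    · exact h.1 ▸ hmem
  exact ⟨mem_properChains.2 ⟨fun S hS => hQ S (hsub hS), toggle_total hD'.2⟩, hsub⟩

/-- If `f` is submodular and vanishes on `∅` and on the whole set, the signed count of chains
on which `f` is nonnegative detects whether `f` is nonnegative everywhere. -/
theorem sum_properChains_nonneg_of_submodular (f : Finset α → ℝ) (h0 : f ∅ = 0)
    (h1 : f Finset.univ = 0) (hf : ∀ S T, f (S ∪ T) + f (S ∩ T) ≤ f S + f T)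
    [Decidable (∀ S, 0 ≤ f S)] [DecidablePred fun C : Finset (Finset α) => ∀ S ∈ C, 0 ≤ f S] :
    ∑ C ∈ (properChains α).filter (fun C => ∀ S ∈ C, 0 ≤ f S), (-1 : ℤ) ^ C.card =
      (-1) ^ (Fintype.card α - 1) * if ∀ S, 0 ≤ f S then 1 else 0 := by
  classical
  let Q : Finset (Finset α) := Finset.univ.filter (fun S => f S < 0)
  have hmemQ : ∀ S, S ∈ Q ↔ f S < 0 := fun S => by simp [Q]
  have hfil : (properChains α).filter (fun C => ∀ S ∈ C, 0 ≤ f S) =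
      (properChains α).filter (fun C => Disjoint C Q) := by
    refine Finset.filter_congr fun C _ => ?_
    simp [Finset.disjoint_left, hmemQ]
  rw [hfil, sum_properChains_disjoint]
  congr 1
  split_ifs with h
  · have hempty : (properChains α).filter (fun D => D ⊆ Q) = {∅} := by
      have : Q = ∅ := Finset.eq_empty_of_forall_notMem fun S hS =>
        ((hmemQ S).1 hS).not_ge (h S)
      ext D
      simp only [this, Finset.subset_empty, Finset.mem_filter, Finset.mem_singleton,
        and_iff_right_iff_imp]
      rintro rfl
      simp [mem_properChains]
    rw [hempty]
    simp
  · push Not at h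
    obtain ⟨S₀, hS₀⟩ := h
    obtain ⟨A, -, hA⟩ := Finset.univ.exists_min_image f ⟨S₀, Finset.mem_univ _⟩
    refine sum_properChains_subset_eq_zero (A := A)
      ((hmemQ A).2 ((hA S₀ (Finset.mem_univ _)).trans_lt hS₀)) (fun S hS => ?_) fun S hS => ?_
    · rw [hmemQ] at hS
      constructor <;> rintro rfl <;> linarith
    · rw [hmemQ] at hS ⊢
      linarith [hf S A, hA (S ∩ A) (Finset.mem_univ _)]

end Chains

theorem basePolytope_subset_hypersimplex {α : Type*} [Fintype α] [DecidableEq α]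
    (rank : Finset α → ℕ) (r : ℕ) (hrank_empty : rank ∅ = 0)
    (hrank_mono : ∀ ⦃S T : Finset α⦄, S ⊆ T → rank S ≤ rank T)
    (hrank_step : ∀ (S : Finset α) (e : α), rank (insert e S) ≤ rank S + 1)
    (hrank_univ : rank Finset.univ = r) : basePolytope rank r ⊆ hypersimplex α r := by
  rintro x ⟨hx, hsum⟩
  refine ⟨fun e => ⟨?_, ?_⟩, hsum⟩
  · have h1 := hx (Finset.univ.erase e)
    have h2 : (rank (Finset.univ.erase e) : ℝ) ≤ r := by
      rw [← hrank_univ]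
      exact_mod_cast hrank_mono (Finset.subset_univ _)
    have h3 := Finset.add_sum_erase Finset.univ x (Finset.mem_univ e)
    linarith
  · have h1 := hx {e}
    have h2 : (rank {e} : ℝ) ≤ 1 := by
      have := hrank_step ∅ e
      rw [hrank_empty] at this
      exact_mod_cast this
    rw [Finset.sum_singleton] at h1
    linarith

/-- Let `M` be a matroid of rank `r` on a ground set `E` with `|E| = n`.
Then, pointwise, `1_{Δ(M)} = Σ_{S•} (-1)^{n-k} 1_{Δ(Ω_{S•,M})}`, the sum being over all
chains `∅ = S₀ ⊊ S₁ ⊊ ⋯ ⊊ S_k = E`.  A chain is recorded by the finite set `C` of its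
intermediate members `S₁, …, S_{k-1}` (a totally ordered family of proper nonempty
subsets), so that `k = |C| + 1`. -/
theorem indicator_basePolytope_eq_sum_schubert {α : Type*} [Fintype α] [DecidableEq α]
    (rank : Finset α → ℕ)
    (hrank_empty : rank ∅ = 0)
    (hrank_mono : ∀ ⦃S T : Finset α⦄, S ⊆ T → rank S ≤ rank T)
    (hrank_submod : ∀ S T : Finset α, rank (S ∪ T) + rank (S ∩ T) ≤ rank S + rank T)
    (hrank_step : ∀ (S : Finset α) (e : α), rank (insert e S) ≤ rank S + 1)
    (n r : ℕ) (hn : Fintype.card α = n) (hrank_univ : rank Finset.univ = r)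
    (x : α → ℝ) :
    Set.indicator (basePolytope rank r) (fun _ => (1 : ℤ)) x =
      ∑ C ∈ Finset.univ.filter (fun C : Finset (Finset α) =>
          (∀ A ∈ C, A ≠ ∅ ∧ A ≠ Finset.univ) ∧
          (∀ A ∈ C, ∀ B ∈ C, A ⊆ B ∨ B ⊆ A)),
        (-1 : ℤ) ^ (n - (C.card + 1)) *
          Set.indicator (schubertPolytope rank r C) (fun _ => (1 : ℤ)) x := by
  classical
  subst hn
  by_cases hx : x ∈ hypersimplex α r
  · let f : Finset α → ℝ := fun S => rank S - ∑ e ∈ S, x e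
    have hbase : x ∈ basePolytope rank r ↔ ∀ S, 0 ≤ f S := by
      simp [basePolytope, f, hx.2]
    have hsch : ∀ C, x ∈ schubertPolytope rank r C ↔ ∀ S ∈ C, 0 ≤ f S := by
      simp [schubertPolytope, f, hx]
    have key := sum_properChains_nonneg_of_submodular f (by simp [f, hrank_empty])
      (by simp [f, hrank_univ, hx.2]) (fun S T => by
        have h1 : (rank (S ∪ T) : ℝ) + rank (S ∩ T) ≤ rank S + rank T := by
          exact_mod_cast hrank_submod S T
        have h2 := Finset.sum_union_inter (s₁ := S) (s₂ := T) (f := x)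
        simp only [f]
        linarith)
    change _ = ∑ C ∈ properChains α, _
    have hterm : ∀ C ∈ properChains α, (-1 : ℤ) ^ (Fintype.card α - (C.card + 1)) *
        Set.indicator (schubertPolytope rank r C) (fun _ => (1 : ℤ)) x =
        (-1) ^ (Fintype.card α - 1) * if ∀ S ∈ C, 0 ≤ f S then (-1 : ℤ) ^ C.card else 0 := by
      intro C hC
      have hle := card_le_of_mem_properChains hC
      simp only [Set.indicator_apply, hsch]
      split_ifs
      · obtain ⟨k, hk⟩ := Nat.exists_eq_add_of_le hle
        rw [show Fintype.card α - (C.card + 1) = k by omega, hk, pow_add, mul_right_comm,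
          ← mul_pow]
        simp
      · simp
    rw [Finset.sum_congr rfl hterm, ← Finset.mul_sum, ← Finset.sum_filter, key, ← mul_assoc,
      ← mul_pow]
    simp [Set.indicator_apply, hbase]
  · rw [Set.indicator_of_notMem fun h => hx (basePolytope_subset_hypersimplex rank r hrank_empty
      hrank_mono hrank_step hrank_univ h)]
    refine (Finset.sum_eq_zero fun C _ => ?_).symm
    rw [Set.indicator_of_notMem fun h => hx h.1, mul_zero]
end

section
/- Let M be a matroid of rank r with finite ground set E, let ℓ ≥ 0, and let ∅ = S₀ ⊊ S₁ ⊊ ⋯ ⊊ S_{r+ℓ} = E be a chain of subsets of E. For 1 ≤ i ≤ r+ℓ let N_i = (M restricted to S_i) contracted by S_{i−1}, a matroid on S_i ∖ S_{i−1}. Then the total number of loops of the matroids N₁, …, N_{r+ℓ} is at most ℓ if and only if exactly ℓ of the N_i are single loops (i.e., |S_i ∖ S_{i−1}| = 1 and rank(S_i) = rank(S_{i−1})) and every other N_i is a loopless matroid of rank 1. In particular, in that case the total number of loops is exactly ℓ. -/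
/-- The loops of the minor `(M | B) / A`, where `M` is given by its rank function. -/
def minorLoops {α : Type*} [DecidableEq α] (rank : Finset α → ℕ) (A B : Finset α) : Finset α :=
  (B \ A).filter fun e => rank (insert e A) = rank A

/-- If `A ⊂ B` and `rank B = rank A`, every element of `B \ A` is a loop of `(M | B) / A`. -/
lemma minorLoops_eq_sdiff {α : Type*} [DecidableEq α] {rank : Finset α → ℕ}
    (hmono : Monotone rank) {A B : Finset α} (hAB : A ⊆ B) (h : rank B = rank A) :
    minorLoops rank A B = B \ A := by
  refine Finset.filter_true_of_mem fun e he => le_antisymm ?_ (hmono (Finset.subset_insert e A))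
  exact h ▸ hmono (Finset.insert_subset (Finset.mem_sdiff.1 he).1 hAB)

/-- The minor `(M | B) / A` on a nonempty ground set has a loop or positive rank. -/
lemma rank_add_one_le_card_minorLoops_add_rank {α : Type*} [DecidableEq α]
    {rank : Finset α → ℕ} (hmono : Monotone rank) {A B : Finset α} (hAB : A ⊂ B) :
    rank A + 1 ≤ (minorLoops rank A B).card + rank B := by
  have hle := hmono hAB.subset
  rcases hle.eq_or_lt with h | h
  · have hpos : 0 < (B \ A).card := Finset.card_pos.2 (Finset.sdiff_nonempty.2 hAB.2)
    rw [minorLoops_eq_sdiff hmono hAB.subset h.symm]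
    omega
  · omega

/-- In a loopless minor `(M | B) / A` of rank `1`, every nonempty set has rank `1`. -/
lemma rank_union_eq_of_minorLoops_eq_empty {α : Type*} [DecidableEq α] {rank : Finset α → ℕ}
    (hmono : Monotone rank) {A B T : Finset α} (hAB : A ⊆ B) (hloops : minorLoops rank A B = ∅)
    (hrank : rank B = rank A + 1) (hT : T ⊆ B \ A) (hne : T.Nonempty) :
    rank (A ∪ T) = rank A + 1 := by
  obtain ⟨e, he⟩ := hne
  have hupper := hmono (Finset.union_subset hAB (hT.trans Finset.sdiff_subset))
  have hinsert := hmono (Finset.subset_insert e A)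
  have hlower : rank (insert e A) ≤ rank (A ∪ T) :=
    hmono (Finset.insert_subset (Finset.mem_union_right A he) Finset.subset_union_left)
  have hne : rank (insert e A) ≠ rank A := Finset.filter_eq_empty_iff.1 hloops (hT he)
  omega

/-- If every nonempty set of `(M | B) / A` has rank `1`, then `(M | B) / A` is loopless. -/
lemma minorLoops_eq_empty {α : Type*} [DecidableEq α] {rank : Finset α → ℕ} {A B : Finset α}
    (h : ∀ T ⊆ B \ A, T ≠ ∅ → rank (A ∪ T) = rank A + 1) : minorLoops rank A B = ∅ := by
  refine Finset.filter_eq_empty_iff.2 fun e he heq => ?_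
  have := h {e} (Finset.singleton_subset_iff.2 he) (Finset.singleton_ne_empty e)
  rw [Finset.union_comm, ← Finset.insert_eq] at this
  omega

lemma sum_succ_add_zero {n : ℕ} (f : Fin (n + 1) → ℕ) :
    ∑ i : Fin n, f i.succ + f 0 = ∑ i : Fin n, f i.castSucc + f (Fin.last n) := by
  rw [add_comm, ← Fin.sum_univ_succ, Fin.sum_univ_castSucc]


/-- Let `M` be a matroid of rank `r` on a finite ground set `E`, let `ℓ ≥ 0`,
and let `∅ = S₀ ⊊ S₁ ⊊ ⋯ ⊊ S_{r+ℓ} = E` be a chain of subsets.  For `1 ≤ i ≤ r + ℓ` let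
`N_i = (M | S_i) / S_{i-1}`, a matroid on `S_i \ S_{i-1}`; an element `e ∈ S_i \ S_{i-1}` is
a loop of `N_i` iff `rank (S_{i-1} ∪ {e}) = rank S_{i-1}`.  Then the total number of loops
of `N₁, …, N_{r+ℓ}` is at most `ℓ` iff exactly `ℓ` of the `N_i` are single loops
(`|S_i \ S_{i-1}| = 1` and `rank S_i = rank S_{i-1}`) and every other `N_i` is a loopless
matroid of rank `1` (every nonempty subset `T` of its ground set satisfies
`rank (S_{i-1} ∪ T) = rank S_{i-1} + 1`).  In particular, in that case the total number of
loops is exactly `ℓ`. -/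
theorem thickened_bergman_chain_characterization {α : Type*} [Fintype α] [DecidableEq α]
    (rank : Finset α → ℕ)
    (hrank_empty : rank ∅ = 0)
    (hrank_mono : ∀ ⦃S T : Finset α⦄, S ⊆ T → rank S ≤ rank T)
    (hrank_submod : ∀ S T : Finset α, rank (S ∪ T) + rank (S ∩ T) ≤ rank S + rank T)
    (hrank_step : ∀ (S : Finset α) (e : α), rank (insert e S) ≤ rank S + 1)
    (r ℓ : ℕ) (hrank_univ : rank Finset.univ = r)
    (S : Fin (r + ℓ + 1) → Finset α)
    (hS0 : S 0 = ∅) (hSlast : S (Fin.last (r + ℓ)) = Finset.univ)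
    (hSchain : StrictMono S) :
    ((∑ i : Fin (r + ℓ), ((S i.succ \ S i.castSucc).filter
          (fun e => rank (insert e (S i.castSucc)) = rank (S i.castSucc))).card ≤ ℓ) ↔
      ((Finset.univ.filter (fun i : Fin (r + ℓ) =>
          (S i.succ \ S i.castSucc).card = 1 ∧ rank (S i.succ) = rank (S i.castSucc))).card
            = ℓ ∧
        ∀ i : Fin (r + ℓ),
          ¬((S i.succ \ S i.castSucc).card = 1 ∧ rank (S i.succ) = rank (S i.castSucc)) →
          ∀ T ⊆ S i.succ \ S i.castSucc, T ≠ ∅ →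
            rank (S i.castSucc ∪ T) = rank (S i.castSucc) + 1)) ∧
    (((Finset.univ.filter (fun i : Fin (r + ℓ) =>
          (S i.succ \ S i.castSucc).card = 1 ∧ rank (S i.succ) = rank (S i.castSucc))).card
            = ℓ ∧
        ∀ i : Fin (r + ℓ),
          ¬((S i.succ \ S i.castSucc).card = 1 ∧ rank (S i.succ) = rank (S i.castSucc)) →
          ∀ T ⊆ S i.succ \ S i.castSucc, T ≠ ∅ →
            rank (S i.castSucc ∪ T) = rank (S i.castSucc) + 1) →
      (∑ i : Fin (r + ℓ), ((S i.succ \ S i.castSucc).filter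
          (fun e => rank (insert e (S i.castSucc)) = rank (S i.castSucc))).card = ℓ)) := by
  have hmono : Monotone rank := hrank_mono
  have hlt (i : Fin (r + ℓ)) : S i.castSucc ⊂ S i.succ := hSchain i.castSucc_lt_succ
  let loops (i : Fin (r + ℓ)) : Finset α := minorLoops rank (S i.castSucc) (S i.succ)
  let single (i : Fin (r + ℓ)) : Prop :=
    (S i.succ \ S i.castSucc).card = 1 ∧ rank (S i.succ) = rank (S i.castSucc)
  let uniform (i : Fin (r + ℓ)) : Prop := ∀ T ⊆ S i.succ \ S i.castSucc, T ≠ ∅ →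
    rank (S i.castSucc ∪ T) = rank (S i.castSucc) + 1
  change (∑ i, (loops i).card ≤ ℓ ↔
    (Finset.univ.filter single).card = ℓ ∧ ∀ i, ¬ single i → uniform i) ∧
    ((Finset.univ.filter single).card = ℓ ∧ (∀ i, ¬ single i → uniform i) →
      ∑ i, (loops i).card = ℓ)
  have hsum (h : ∀ i, ¬ single i → uniform i) :
      ∑ i, (loops i).card = (Finset.univ.filter single).card := by
    rw [Finset.card_filter]
    refine Finset.sum_congr rfl fun i _ => ?_
    split_ifs with hi
    · exact (congrArg _ (minorLoops_eq_sdiff hmono (hlt i).subset hi.2)).trans hi.1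
    · exact Finset.card_eq_zero.2 (minorLoops_eq_empty (h i hi))
  refine ⟨⟨fun hle => ?_, fun h => (hsum h.2).trans h.1 |>.le⟩, fun h => (hsum h.2).trans h.1⟩
  have hstep (i : Fin (r + ℓ)) :
      rank (S i.castSucc) + 1 ≤ (loops i).card + rank (S i.succ) :=
    rank_add_one_le_card_minorLoops_add_rank hmono (hlt i)
  have htel := sum_succ_add_zero fun i => rank (S i)
  rw [hS0, hSlast, hrank_empty, hrank_univ] at htel
  have htotal : ∑ i : Fin (r + ℓ), (rank (S i.castSucc) + 1) ≤
      ∑ i, ((loops i).card + rank (S i.succ)) :=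
    Finset.sum_le_sum fun i _ => hstep i
  have htotal_eq : ∑ i : Fin (r + ℓ), (rank (S i.castSucc) + 1) =
      ∑ i, ((loops i).card + rank (S i.succ)) := by
    refine htotal.antisymm ?_
    simp only [Finset.sum_add_distrib, Finset.sum_const, Finset.card_univ, Fintype.card_fin,
      smul_eq_mul, mul_one]
    omega
  have hstep_eq (i : Fin (r + ℓ)) :
      rank (S i.castSucc) + 1 = (loops i).card + rank (S i.succ) :=
    (Finset.sum_eq_sum_iff_of_le fun i _ => hstep i).1 htotal_eq i (Finset.mem_univ i)
  have huniform (i : Fin (r + ℓ)) (hi : ¬ single i) : uniform i := by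
    have hstep_i := hstep_eq i
    have hrank_le := hmono (hlt i).subset
    rcases hrank_le.eq_or_lt with h | h
    · refine absurd ⟨?_, h.symm⟩ hi
      rw [← minorLoops_eq_sdiff hmono (hlt i).subset h.symm]
      change (loops i).card = 1
      omega
    · have hloops : loops i = ∅ := Finset.card_eq_zero.1 (by omega)
      exact fun T hT hne => rank_union_eq_of_minorLoops_eq_empty hmono (hlt i).subset hloops
        (by omega) hT (Finset.nonempty_iff_ne_empty.2 hne)
  refine ⟨?_, huniform⟩
  rw [← hsum huniform]
  simp only [Finset.sum_add_distrib, Finset.sum_const, Finset.card_univ, Fintype.card_fin,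
    smul_eq_mul, mul_one] at htotal_eq
  omega
end

section
/- Let M be a simple connected matroid of rank 3 with finite ground set E of cardinality n. Then Σ_L C(|L| − 2, 2) ≤ C(n − 4, 2), where the sum ranges over all flats L of M of rank 2, and C(·,·) denotes the binomial coefficient. -/
/-- A family of finite sets, any two distinct members of which share at most one point, satisfies
`∑ C(|L| - 2, 2) ≤ C(n - 4, 2)` as soon as there are four points of which no member contains
three. -/
theorem sum_choose_card_sub_two_le {α : Type*} [Fintype α] [DecidableEq α]
    (F : Finset (Finset α))
    (hF : ∀ L ∈ F, ∀ L' ∈ F, 2 ≤ (L ∩ L').card → L = L')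
    (A : Finset α) (hA : A.card = 4) (hAF : ∀ L ∈ F, (L ∩ A).card ≤ 2) :
    ∑ L ∈ F, Nat.choose (L.card - 2) 2 ≤ Nat.choose (Fintype.card α - 4) 2 := by
  calc ∑ L ∈ F, Nat.choose (L.card - 2) 2
      ≤ ∑ L ∈ F, ((L \ A).powersetCard 2).card := by
        refine Finset.sum_le_sum fun L hL => ?_
        rw [Finset.card_powersetCard]
        apply Nat.choose_le_choose
        have := hAF L hL
        have := Finset.card_sdiff_add_card_inter L A
        omega
    _ = (F.biUnion fun L => (L \ A).powersetCard 2).card := by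
        refine (Finset.card_biUnion fun L hL L' hL' hne => ?_).symm
        refine Finset.disjoint_left.2 fun s hs hs' => hne (hF L hL L' hL' ?_)
        rw [Finset.mem_powersetCard] at hs hs'
        rw [← hs.2]
        exact Finset.card_le_card (Finset.subset_inter (hs.1.trans Finset.sdiff_subset)
          (hs'.1.trans Finset.sdiff_subset))
    _ ≤ ((Finset.univ \ A).powersetCard 2).card := by
        refine Finset.card_le_card (Finset.biUnion_subset.2 fun L _ => ?_)
        exact Finset.powersetCard_mono (Finset.sdiff_subset_sdiff (Finset.subset_univ L) le_rfl)
    _ = Nat.choose (Fintype.card α - 4) 2 := by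
        rw [Finset.card_powersetCard, Finset.card_univ_sdiff, hA]


/-- Let `M` be a simple connected matroid of rank `3` on a finite ground
set `E` of cardinality `n`.  Then `Σ_L C(|L| - 2, 2) ≤ C(n - 4, 2)`, where `L` ranges over
the rank-`2` flats of `M`. -/
theorem rank_three_flat_inequality {α : Type*} [Fintype α] [DecidableEq α]
    (rank : Finset α → ℕ)
    (hrank_empty : rank ∅ = 0)
    (hrank_mono : ∀ ⦃S T : Finset α⦄, S ⊆ T → rank S ≤ rank T)
    (hrank_submod : ∀ S T : Finset α, rank (S ∪ T) + rank (S ∩ T) ≤ rank S + rank T)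
    (hrank_step : ∀ (S : Finset α) (e : α), rank (insert e S) ≤ rank S + 1)
    (n : ℕ) (hn : Fintype.card α = n)
    (hsimple : ∀ S : Finset α, S.card ≤ 2 → rank S = S.card)
    (hconn : ∀ S : Finset α, S ≠ ∅ → S ≠ Finset.univ →
      rank S + rank (Finset.univ \ S) ≠ rank Finset.univ)
    (hrank_univ : rank Finset.univ = 3) :
    ∑ L ∈ Finset.univ.filter (fun L : Finset α =>
        (∀ e : α, e ∉ L → rank L < rank (insert e L)) ∧ rank L = 2),
      Nat.choose (L.card - 2) 2 ≤ Nat.choose (n - 4) 2 := by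
  subst hn
  have hsub : ∀ S T U : Finset α, U.card = 2 → U ⊆ S → U ⊆ T → rank S ≤ 2 → rank T ≤ 2 →
      rank (S ∪ T) ≤ 2 := by
    intro S T U hU hS hT hrS hrT
    have h1 := hrank_submod S T
    have h2 := hrank_mono (Finset.subset_inter hS hT)
    have h3 := hsimple U hU.le
    omega
  have hpair : ∀ x y : α, x ≠ y → ({x, y} : Finset α).card = 2 := fun x y h =>
    Finset.card_pair h
  set F := Finset.univ.filter (fun L : Finset α =>
    (∀ e : α, e ∉ L → rank L < rank (insert e L)) ∧ rank L = 2) with hFdef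
  have hle : ∀ L ∈ F, ∀ L' ∈ F, 2 ≤ (L ∩ L').card → L' ⊆ L := by
    intro L hL L' hL' hc e he
    simp only [hFdef, Finset.mem_filter, Finset.mem_univ, true_and] at hL hL'
    by_contra heL
    obtain ⟨U, hU, hUc⟩ := Finset.exists_subset_card_eq hc
    have h1 := hsub L L' U hUc (hU.trans Finset.inter_subset_left)
      (hU.trans Finset.inter_subset_right) hL.2.le hL'.2.le
    have h2 : rank (insert e L) ≤ rank (L ∪ L') := hrank_mono (by grind)
    have h3 := hL.1 e heL
    omega
  have hF : ∀ L ∈ F, ∀ L' ∈ F, 2 ≤ (L ∩ L').card → L = L' := fun L hL L' hL' hc =>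
    (hle L' hL' L hL (by rwa [Finset.inter_comm])).antisymm (hle L hL L' hL' hc)
  by_cases hbig : ∃ L ∈ F, 4 ≤ L.card
  · obtain ⟨L, hLF, hL4⟩ := hbig
    have hL := hLF
    simp only [hFdef, Finset.mem_filter, Finset.mem_univ, true_and] at hL
    have hcompl : 1 < (Finset.univ \ L).card := by
      by_contra hlt
      have h1 := hsimple (Finset.univ \ L) (by omega)
      have h2 : L ≠ ∅ := by rintro rfl; simp at hL4
      have h3 : L ≠ Finset.univ := by rintro rfl; omega
      have h4 : 0 < (Finset.univ \ L).card := by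
        rw [Finset.card_pos, Finset.sdiff_nonempty]
        exact fun h => h3 (Finset.univ_subset_iff.1 h)
      exact hconn L h2 h3 (by omega)
    obtain ⟨p, hp, q, hq, hpq⟩ := Finset.one_lt_card.1 hcompl
    simp only [Finset.mem_sdiff, Finset.mem_univ, true_and] at hp hq
    set B := L.filter (fun x => rank {x, p, q} ≤ 2) with hB
    have hBcard : B.card ≤ 1 := by
      refine Finset.card_le_one.2 fun x hx y hy => ?_
      by_contra hxy
      simp only [hB, Finset.mem_filter] at hx hy
      have h1 := hsub {x, p, q} {y, p, q} {p, q} (hpair p q hpq) (by grind) (by grind) hx.2 hy.2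
      have h2 := hsub L _ {x, y} (hpair x y hxy) (by grind) (by grind) hL.2.le h1
      have h3 := hL.1 p hp
      have h4 : rank (insert p L) ≤ rank (L ∪ ({x, p, q} ∪ {y, p, q})) :=
        hrank_mono (by grind)
      omega
    have hLB : 1 < (L \ B).card := by
      have := Finset.le_card_sdiff B L
      omega
    obtain ⟨a, ha, b, hb, hab⟩ := Finset.one_lt_card.1 hLB
    simp only [hB, Finset.mem_sdiff, Finset.mem_filter, not_and, not_le] at ha hb
    have hpa : p ≠ a := by rintro rfl; exact hp ha.1
    have hpb : p ≠ b := by rintro rfl; exact hp hb.1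
    have hqa : q ≠ a := by rintro rfl; exact hq ha.1
    have hqb : q ≠ b := by rintro rfl; exact hq hb.1
    refine sum_choose_card_sub_two_le F hF {a, b, p, q} (by grind) fun K hK => ?_
    have hK2 : rank K = 2 := (Finset.mem_filter.1 hK).2.2
    have hnot : ∀ x, 2 < rank {x, p, q} → ¬ (x ∈ K ∧ p ∈ K ∧ q ∈ K) := by
      rintro x hx ⟨h1, h2, h3⟩
      have : rank {x, p, q} ≤ rank K := hrank_mono (by simp [Finset.insert_subset_iff, h1, h2, h3])
      omega
    have hna := hnot a (ha.2 ha.1)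
    have hnb := hnot b (hb.2 hb.1)
    have hnab : a ∈ K → b ∈ K → p ∉ K ∧ q ∉ K := by
      intro h1 h2
      have h3 : K = L := by
        refine hF K hK L hLF ?_
        rw [← hpair a b hab]
        exact Finset.card_le_card (by grind)
      exact h3 ▸ ⟨hp, hq⟩
    have key : ∃ x y, K ∩ {a, b, p, q} ⊆ {x, y} := by
      clear * - hna hnb hnab
      by_cases h1 : a ∈ K <;> by_cases h2 : p ∈ K
      · exact ⟨a, p, by grind⟩
      · by_cases h3 : b ∈ K
        · exact ⟨a, b, by grind⟩
        · exact ⟨a, q, by grind⟩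
      · by_cases h3 : b ∈ K
        · exact ⟨b, p, by grind⟩
        · exact ⟨p, q, by grind⟩
      · exact ⟨b, q, by grind⟩
    obtain ⟨x, y, hxy⟩ := key
    exact (Finset.card_le_card hxy).trans Finset.card_le_two
  · rw [Finset.sum_eq_zero]
    · exact Nat.zero_le _
    · intro L hL
      have : ¬ 4 ≤ L.card := fun h => hbig ⟨L, hL, h⟩
      exact Nat.choose_eq_zero_of_lt (by omega)
end

section
/- Let M be a simple connected matroid of rank 3 with finite ground set E. Then there exist four distinct elements p₁, p₂, p₃, p₄ ∈ E such that every 3-element subset of {p₁, p₂, p₃, p₄} is independent in M (equivalently, is a basis of M). -/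
/-- In a collinearity relation, a point `p` on the line `xy` and a point `q` on the line `xz`,
neither of them a vertex of the triangle `xyz`, form a quadrangle with `y` and `z`. -/
theorem quadrangle_of_two_sides {α : Type*} {C : α → α → α → Prop}
    (hswap : ∀ x y z, C x y z → C y x z) (hrot : ∀ x y z, C x y z → C y z x)
    (hexch : ∀ x y p q, x ≠ y → C x y p → C x y q → C x p q)
    {x y z p q : α} (hxyz : ¬ C x y z) (hp : C x y p) (hpx : p ≠ x) (hpy : p ≠ y)
    (hq : C x z q) (hqx : q ≠ x) (hqz : q ≠ z) :
    ¬ C y p z ∧ ¬ C y p q ∧ ¬ C y z q ∧ ¬ C p z q := by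
  grind

/-- If every point lies on a side of the triangle `abc`, and no side contains all points other
than the opposite vertex, then there is a quadrangle. -/
theorem exists_quadrangle_of_triangle {α : Type*} {C : α → α → α → Prop}
    (hdeg : ∀ x y, C x x y)
    (hswap : ∀ x y z, C x y z → C y x z) (hrot : ∀ x y z, C x y z → C y z x)
    (hexch : ∀ x y p q, x ≠ y → C x y p → C x y q → C x p q)
    {a b c d e f : α} (habc : ¬ C a b c) (hdc : d ≠ c) (hd : ¬ C a b d)
    (heb : e ≠ b) (he : ¬ C a c e) (hfa : f ≠ a) (hf : ¬ C b c f) :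
    ∃ p q r s, ¬ C p q r ∧ ¬ C p q s ∧ ¬ C p r s ∧ ¬ C q r s := by
  have side : ∀ x y z p q : α, ¬ C x y z → C x y p → p ≠ x → p ≠ y → C x z q → q ≠ x → q ≠ z →
      ∃ p q r s, ¬ C p q r ∧ ¬ C p q s ∧ ¬ C p r s ∧ ¬ C q r s :=
    fun x y z p q hxyz hp hpx hpy hq hqx hqz =>
      ⟨y, p, z, q, quadrangle_of_two_sides hswap hrot hexch hxyz hp hpx hpy hq hqx hqz⟩
  have off : ∀ p, ¬ C a b p → ¬ C a c p → ¬ C b c p →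
      ∃ p q r s, ¬ C p q r ∧ ¬ C p q s ∧ ¬ C p r s ∧ ¬ C q r s :=
    fun p h₁ h₂ h₃ => ⟨a, b, c, p, habc, h₁, h₂, h₃⟩
  have hda : d ≠ a := by grind
  have hdb : d ≠ b := by grind
  have hea : e ≠ a := by grind
  have hec : e ≠ c := by grind
  have hfb : f ≠ b := by grind
  have hfc : f ≠ c := by grind
  have hbac : ¬ C b a c := fun h => habc (hswap _ _ _ h)
  have hcab : ¬ C c a b := fun h => habc (hrot _ _ _ h)
  by_cases hdac : C a c d
  · by_cases heab : C a b e
    · exact side a b c e d habc heab hea heb hdac hda hdc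
    · by_cases hebc : C b c e
      · exact side c a b d e hcab (hswap _ _ _ hdac) hdc hda (hswap _ _ _ hebc) hec heb
      · exact off e heab he hebc
  · by_cases hdbc : C b c d
    · by_cases hfab : C a b f
      · exact side b a c f d hbac (hswap _ _ _ hfab) hfb hfa hdbc hdb hdc
      · by_cases hfac : C a c f
        · exact side c a b f d hcab (hswap _ _ _ hfac) hfc hfa (hswap _ _ _ hdbc) hdc hdb
        · exact off f hfab hfac hf
    · exact off d hd hdac hdbc

section RankFunction

variable {α : Type*} [DecidableEq α] {rank : Finset α → ℕ}

theorem rank_union_le_of_le_of_subset (hmono : ∀ ⦃S T : Finset α⦄, S ⊆ T → rank S ≤ rank T)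
    (hsubmod : ∀ S T : Finset α, rank (S ∪ T) + rank (S ∩ T) ≤ rank S + rank T)
    {A S T : Finset α} {k : ℕ} (hA : rank A = k) (hAS : A ⊆ S) (hAT : A ⊆ T)
    (hS : rank S ≤ k) (hT : rank T ≤ k) : rank (S ∪ T) ≤ k := by
  have h₁ := hsubmod S T
  have h₂ := hmono (Finset.subset_inter hAS hAT)
  omega

theorem rank_union_le_of_forall_rank_insert_le
    (hmono : ∀ ⦃S T : Finset α⦄, S ⊆ T → rank S ≤ rank T)
    (hsubmod : ∀ S T : Finset α, rank (S ∪ T) + rank (S ∩ T) ≤ rank S + rank T)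
    {A S : Finset α} (h : ∀ d ∈ S, rank (insert d A) ≤ rank A) : rank (A ∪ S) ≤ rank A := by
  induction S using Finset.induction_on with
  | empty => simp
  | insert d S _ ih =>
    have hS := ih fun e he => h e (Finset.mem_insert_of_mem he)
    have := rank_union_le_of_le_of_subset hmono hsubmod rfl Finset.subset_union_left
      (Finset.subset_insert d A) hS (h d (Finset.mem_insert_self d S))
    exact (hmono (by grind)).trans this

theorem rank_triple_le_of_rank_pair_eq
    (hmono : ∀ ⦃S T : Finset α⦄, S ⊆ T → rank S ≤ rank T)
    (hsubmod : ∀ S T : Finset α, rank (S ∪ T) + rank (S ∩ T) ≤ rank S + rank T)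
    {x y p q : α} {k : ℕ} (hxy : rank {x, y} = k) (hp : rank {x, y, p} ≤ k)
    (hq : rank {x, y, q} ≤ k) : rank {x, p, q} ≤ k :=
  (hmono (by clear * -; grind)).trans (rank_union_le_of_le_of_subset hmono hsubmod hxy
    (by clear * -; grind) (by clear * -; grind) hp hq)

end RankFunction

/-- Let `M` be a simple connected matroid of rank `3` on a finite ground
set `E`.  Then there exist four distinct elements `p₁, p₂, p₃, p₄ ∈ E` such that every
`3`-element subset of `{p₁, p₂, p₃, p₄}` is independent in `M` (i.e. has rank `3`, so is a
basis of `M`). -/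
theorem exists_four_points_general_position {α : Type*} [Fintype α] [DecidableEq α]
    (rank : Finset α → ℕ)
    (hrank_empty : rank ∅ = 0)
    (hrank_mono : ∀ ⦃S T : Finset α⦄, S ⊆ T → rank S ≤ rank T)
    (hrank_submod : ∀ S T : Finset α, rank (S ∪ T) + rank (S ∩ T) ≤ rank S + rank T)
    (hrank_step : ∀ (S : Finset α) (e : α), rank (insert e S) ≤ rank S + 1)
    (hsimple : ∀ S : Finset α, S.card ≤ 2 → rank S = S.card)
    (hconn : ∀ S : Finset α, S ≠ ∅ → S ≠ Finset.univ →
      rank S + rank (Finset.univ \ S) ≠ rank Finset.univ)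
    (hrank_univ : rank Finset.univ = 3) :
    ∃ p₁ p₂ p₃ p₄ : α, p₁ ≠ p₂ ∧ p₁ ≠ p₃ ∧ p₁ ≠ p₄ ∧ p₂ ≠ p₃ ∧ p₂ ≠ p₄ ∧ p₃ ≠ p₄ ∧
      ∀ T ⊆ ({p₁, p₂, p₃, p₄} : Finset α), T.card = 3 → rank T = 3 := by
  set C : α → α → α → Prop := fun x y z => rank {x, y, z} ≤ 2 with hC
  have hpair : ∀ {x y : α}, x ≠ y → rank {x, y} = 2 := fun {x y} hxy => by
    rw [hsimple _ Finset.card_le_two, Finset.card_pair hxy]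
  have hdeg : ∀ x y, C x x y := fun x y => by
    have hcard : ({x, y} : Finset α).card ≤ 2 := Finset.card_le_two
    simpa [hC, hsimple _ hcard] using hcard
  have hswap : ∀ x y z, C x y z → C y x z := fun x y z h => by
    simpa only [hC, Finset.insert_comm y x] using h
  have hrot : ∀ x y z, C x y z → C y z x := fun x y z h =>
    (hrank_mono (by clear * -; grind)).trans h
  have hdeg₂₃ : ∀ x y, C x y y := fun x y => hrot _ _ _ (hrot _ _ _ (hdeg y x))
  have hdeg₁₃ : ∀ x y, C x y x := fun x y => hswap _ _ _ (hdeg₂₃ y x)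
  have hexch : ∀ x y p q, x ≠ y → C x y p → C x y q → C x p q := fun x y p q hxy hp hq =>
    rank_triple_le_of_rank_pair_eq hrank_mono hrank_submod (hpair hxy) hp hq
  have hline : ∀ (S : Finset α) (a b : α), a ≠ b → 2 < rank S → ∃ d ∈ S, ¬ C a b d := by
    intro S a b hab hS
    by_contra! h
    have hle := rank_union_le_of_forall_rank_insert_le hrank_mono hrank_submod
      (A := {a, b}) (S := S) fun d hd => by
        rw [hpair hab]
        exact (hrank_mono (by clear * -; grind)).trans (h d hd)
    have := hrank_mono (Finset.subset_union_right (s₁ := {a, b}) (s₂ := S))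
    rw [hpair hab] at hle
    omega
  have hdelete : ∀ c : α, 2 < rank (Finset.univ \ {c}) := by
    intro c
    have hc : rank {c} = 1 := by rw [hsimple _ (by simp), Finset.card_singleton]
    have hne := hconn {c} (Finset.singleton_ne_empty c) fun h => by
      rw [h, hrank_univ] at hc
      omega
    have hle := hrank_submod {c} (Finset.univ \ {c})
    rw [Finset.union_sdiff_of_subset (Finset.subset_univ _)] at hle
    omega
  obtain ⟨a, b, hab⟩ : ∃ a b : α, a ≠ b := by
    by_contra! h
    have hcard : (Finset.univ : Finset α).card ≤ 1 :=
      Finset.card_le_one.2 fun a _ b _ => h a b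
    have := hsimple _ (hcard.trans one_le_two)
    omega
  obtain ⟨c, -, habc⟩ := hline Finset.univ a b hab (by omega)
  have hac : a ≠ c := by
    rintro rfl
    exact habc (hdeg₁₃ _ _)
  have hbc : b ≠ c := by
    rintro rfl
    exact habc (hdeg₂₃ _ _)
  obtain ⟨d, hdc, hd⟩ := hline _ a b hab (hdelete c)
  obtain ⟨e, heb, he⟩ := hline _ a c hac (hdelete b)
  obtain ⟨f, hfa, hf⟩ := hline _ b c hbc (hdelete a)
  obtain ⟨p, q, r, s, hpqr, hpqs, hprs, hqrs⟩ := exists_quadrangle_of_triangle hdeg hswap hrot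
    hexch habc (by simpa using hdc) hd (by simpa using heb) he (by simpa using hfa) hf
  have hpq : p ≠ q := by
    rintro rfl
    exact hpqr (hdeg _ _)
  have hpr : p ≠ r := by
    rintro rfl
    exact hpqr (hdeg₁₃ _ _)
  have hps : p ≠ s := by
    rintro rfl
    exact hpqs (hdeg₁₃ _ _)
  have hqr : q ≠ r := by
    rintro rfl
    exact hpqr (hdeg₂₃ _ _)
  have hqs : q ≠ s := by
    rintro rfl
    exact hpqs (hdeg₂₃ _ _)
  have hrs : r ≠ s := by
    rintro rfl
    exact hprs (hdeg₂₃ _ _)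
  refine ⟨p, q, r, s, hpq, hpr, hps, hqr, hqs, hrs, fun T hT hcard => ?_⟩
  have hle : rank T ≤ 3 := hrank_univ ▸ hrank_mono (Finset.subset_univ T)
  by_contra hne
  have hTC : ∀ x y z, x ∈ T → y ∈ T → z ∈ T → C x y z := fun x y z hx hy hz =>
    (hrank_mono (by clear * - hx hy hz; grind)).trans (show rank T ≤ 2 by omega)
  have hcover : ∀ x y : α, x ∈ ({p, q, r, s} : Finset α) → y ∈ ({p, q, r, s} : Finset α) →
      x ≠ y → x ∈ T ∨ y ∈ T := by
    intro x y hx hy hxy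
    by_contra! h
    have hsub : T ⊆ (({p, q, r, s} : Finset α).erase x).erase y := by
      clear * - hT h
      grind
    have := Finset.card_le_card hsub
    have hfour : ({p, q, r, s} : Finset α).card ≤ 4 := Finset.card_le_four
    rw [Finset.card_erase_of_mem (Finset.mem_erase.2 ⟨hxy.symm, hy⟩),
      Finset.card_erase_of_mem hx] at this
    omega
  have hpq' := hcover p q (by simp) (by simp) hpq
  have hpr' := hcover p r (by simp) (by simp) hpr
  have hps' := hcover p s (by simp) (by simp) hps
  have hqr' := hcover q r (by simp) (by simp) hqr
  have hqs' := hcover q s (by simp) (by simp) hqs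
  have hrs' := hcover r s (by simp) (by simp) hrs
  have hpqr' := fun hp hq hr => hpqr (hTC p q r hp hq hr)
  have hpqs' := fun hp hq hs => hpqs (hTC p q s hp hq hs)
  have hprs' := fun hp hr hs => hprs (hTC p r s hp hr hs)
  have hqrs' := fun hq hr hs => hqrs (hTC q r s hq hr hs)
  clear * - hpq' hpr' hps' hqr' hqs' hrs' hpqr' hpqs' hprs' hqrs'
  grind
end
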